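/- arXiv:2603.10746 — 5 statements merged into one kernel-verified Lean document; each statement's English description precedes it below -/
import Mathlib

section
/- Let a, b, c be nonzero setwise coprime integers, let d ≥ 1 be an integer, and let q be a prime. If L, M, N ≥ 1 are reals with L·M·N ≤ (1/6)·q^{1/(2·d·max(|a|,|b|,|c|))}, then N_{a,b,c,d}(L, M, N; q) = 0. -/
/-- `N_{a,b,c,d}(L,M,N;q)`: the number of triples `(l,m,n)` of natural numbers with
`L ≤ l < 2L`, `M ≤ m < 2M`, `N ≤ n < 2N`, `q ∤ lmn`, `(l^a m^b n^c)^d = 1` in `(ℤ/qℤ)ˣ`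
and `l^a m^b n^c ≠ 1` in `ℚ`. -/
noncomputable def Ncount (a b c : ℤ) (d : ℕ) (L M N : ℝ) (q : ℕ) : ℕ :=
  Set.ncard {p : ℕ × ℕ × ℕ |
    ((L ≤ (p.1 : ℝ) ∧ (p.1 : ℝ) < 2 * L) ∧ (M ≤ (p.2.1 : ℝ) ∧ (p.2.1 : ℝ) < 2 * M) ∧
      (N ≤ (p.2.2 : ℝ) ∧ (p.2.2 : ℝ) < 2 * N)) ∧
    ¬(q ∣ p.1 * p.2.1 * p.2.2) ∧
    (∃ ul um un : (ZMod q)ˣ, (ul : ZMod q) = (p.1 : ZMod q) ∧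
      (um : ZMod q) = (p.2.1 : ZMod q) ∧ (un : ZMod q) = (p.2.2 : ZMod q) ∧
      (ul ^ a * um ^ b * un ^ c) ^ (d : ℤ) = 1) ∧
    (p.1 : ℚ) ^ a * (p.2.1 : ℚ) ^ b * (p.2.2 : ℚ) ^ c ≠ 1}

/-- An integer power is the quotient of the powers by the positive and the negative part. -/
theorem zpow_eq_pow_toNat_div {G : Type*} [DivisionMonoid G] (u : G) (a : ℤ) :
    u ^ a = u ^ a.toNat / u ^ (-a).toNat := by
  rcases le_total 0 a with h | h
  · lift a to ℕ using h
    simp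
  · obtain ⟨n, rfl⟩ : ∃ n : ℕ, a = -n := ⟨a.natAbs, by omega⟩
    have : (-(n : ℤ)).toNat = 0 := by omega
    simp [this]

theorem pow_mul_pow_mul_pow_le {l m n i j k e : ℕ} (hl : 0 < l) (hm : 0 < m) (hn : 0 < n)
    (hi : i ≤ e) (hj : j ≤ e) (hk : k ≤ e) :
    l ^ i * m ^ j * n ^ k ≤ (l * m * n) ^ e := by
  rw [mul_pow, mul_pow]
  gcongr

/-- if `L·M·N ≤ (1/6) q^{1/(2 d max(|a|,|b|,|c|))}` then
`N_{a,b,c,d}(L,M,N;q) = 0`. -/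
theorem Ncount_eq_zero_of_small
    (a b c : ℤ) (ha : a ≠ 0) (hb : b ≠ 0) (hc : c ≠ 0)
    (hcop : Int.gcd a (Int.gcd b c) = 1) (d : ℕ) (hd : 1 ≤ d)
    (q : ℕ) (hq : q.Prime) (L M N : ℝ) (hL : 1 ≤ L) (hM : 1 ≤ M) (hN : 1 ≤ N)
    (hsize : L * M * N ≤ (1 / 6) *
      (q : ℝ) ^ ((1 : ℝ) / (2 * d * (max (max a.natAbs b.natAbs) c.natAbs : ℕ)))) :
    Ncount a b c d L M N q = 0 := by
  set K := max (max a.natAbs b.natAbs) c.natAbs with hK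
  have hKpos : 0 < K := by omega
  unfold Ncount
  refine (congrArg Set.ncard (Set.eq_empty_of_forall_notMem ?_)).trans (Set.ncard_empty _)
  rintro ⟨l, m, n⟩ ⟨⟨⟨hl, hl2⟩, ⟨hm, hm2⟩, ⟨hn, hn2⟩⟩, -, ⟨u, v, w, hu, hv, hw, huvw⟩, hne⟩
  dsimp only at *
  have hl0 : 0 < l := by exact_mod_cast (by linarith : (0 : ℝ) < l)
  have hm0 : 0 < m := by exact_mod_cast (by linarith : (0 : ℝ) < m)
  have hn0 : 0 < n := by exact_mod_cast (by linarith : (0 : ℝ) < n)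
  set x : ℝ := (q : ℝ) ^ ((1 : ℝ) / (2 * d * (K : ℕ))) with hx
  have hxq : x ^ (2 * d * K) = q := by
    have hne0 : 2 * d * K ≠ 0 := by positivity
    have := Real.rpow_inv_natCast_pow (Nat.cast_nonneg (α := ℝ) q) hne0
    rw [hx, one_div]
    exact_mod_cast this
  have hLMN : 1 ≤ L * M * N := one_le_mul_of_one_le_of_one_le
    (one_le_mul_of_one_le_of_one_le hL hM) hN
  have hprod : (l * m * n : ℝ) < x ^ 2 := by
    have : (l * m * n : ℝ) < 2 * L * (2 * M) * (2 * N) := by gcongr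
    nlinarith
  have hlt : (l * m * n) ^ (K * d) < q := by
    have : ((l * m * n : ℕ) : ℝ) ^ (K * d) < (q : ℝ) := by
      rw [← hxq, show 2 * d * K = 2 * (K * d) by ring, pow_mul x]
      push_cast
      exact pow_lt_pow_left₀ hprod (by positivity) (Nat.mul_pos hKpos hd).ne'
    exact_mod_cast this
  have hbound {i j k : ℕ} (hi : i ≤ K) (hj : j ≤ K) (hk : k ≤ K) :
      (l ^ i * m ^ j * n ^ k) ^ d < q := by
    refine lt_of_le_of_lt ?_ hlt
    rw [pow_mul]
    exact Nat.pow_le_pow_left (pow_mul_pow_mul_pow_le hl0 hm0 hn0 hi hj hk) d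
  have hunits : (u ^ a.toNat * v ^ b.toNat * w ^ c.toNat) ^ d =
      (u ^ (-a).toNat * v ^ (-b).toNat * w ^ (-c).toNat) ^ d := by
    rw [zpow_eq_pow_toNat_div u, zpow_eq_pow_toNat_div v, zpow_eq_pow_toNat_div w,
      div_mul_div_comm, div_mul_div_comm, zpow_natCast, div_pow, div_eq_one] at huvw
    exact huvw
  have hcongr : (l ^ a.toNat * m ^ b.toNat * n ^ c.toNat) ^ d ≡
      (l ^ (-a).toNat * m ^ (-b).toNat * n ^ (-c).toNat) ^ d [MOD q] := by
    rw [← ZMod.natCast_eq_natCast_iff]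
    have := congrArg Units.val hunits
    push_cast at this ⊢
    rwa [hu, hv, hw] at this
  have heq := Nat.pow_left_injective (by omega : d ≠ 0) (hcongr.eq_of_lt_of_lt
    (hbound (by omega) (by omega) (by omega)) (hbound (by omega) (by omega) (by omega)))
  apply hne
  rw [zpow_eq_pow_toNat_div (l : ℚ), zpow_eq_pow_toNat_div (m : ℚ), zpow_eq_pow_toNat_div (n : ℚ),
    div_mul_div_comm, div_mul_div_comm, div_eq_one_iff_eq (by positivity)]
  exact_mod_cast heq
end

section
/- Let a, b, c be nonzero setwise coprime integers and d ≥ 1 an integer. For every ε > 0 there is C ≥ 0 (depending only on a, b, c, d, ε) such that for every real Q ≥ 2 and all reals L, M, N ≥ 1: (1/#{primes q with Q ≤ q < 2Q}) · Σ_{q prime, Q ≤ q < 2Q} N_{a,b,c,d}(L, M, N; q) ≤ C·Q^ε·(L·M·N)/Q. -/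
open scoped Classical in
/-- The set of primes `q` with `Q ≤ q < 2Q`. -/
noncomputable def primesIn (Q : ℝ) : Finset ℕ :=
  (Finset.range (Nat.ceil (2 * Q) + 1)).filter
    fun q => q.Prime ∧ Q ≤ (q : ℝ) ∧ (q : ℝ) < 2 * Q

open Finset in
/-- Bound on the central binomial coefficient in terms of the number of primes in `(n, 2n]`. -/
theorem centralBinom_le_pow_card_primes (n : ℕ) (hn : 2 < n) :
    n.centralBinom ≤ (2 * n) ^ (2 * n).sqrt * 4 ^ (2 * n / 3) *
      (2 * n) ^ #{p ∈ range (2 * n + 1) | p.Prime ∧ n < p} := by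
  have h2n : 1 ≤ 2 * n := by lia
  rw [← n.prod_pow_factorization_centralBinom]
  have key : ∀ p ∈ range (2 * n + 1), p ^ n.centralBinom.factorization p ≤
      (if p ∈ Icc 1 (2 * n).sqrt then 2 * n else 1) *
      (if p.Prime ∧ p ≤ 2 * n / 3 then p else 1) *
      (if p.Prime ∧ n < p then 2 * n else 1) := by
    intro p hp
    by_cases hpp : p.Prime
    swap
    · rw [Nat.factorization_eq_zero_of_not_prime _ hpp, pow_zero]
      simp only [hpp, false_and, if_false, mul_one]
      split_ifs <;> lia
    have hle : p ^ n.centralBinom.factorization p ≤ 2 * n :=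
      Nat.pow_factorization_choose_le (by lia)
    have h1 := hpp.one_lt.le
    have hg1 : 1 ≤ if p ∈ Icc 1 (2 * n).sqrt then 2 * n else 1 := by split_ifs <;> lia
    have hg2 : 1 ≤ if p.Prime ∧ p ≤ 2 * n / 3 then p else 1 := by split_ifs <;> lia
    have hg3 : 1 ≤ if p.Prime ∧ n < p then 2 * n else 1 := by split_ifs <;> lia
    by_cases hs : p ≤ (2 * n).sqrt
    · rw [if_pos (mem_Icc.2 ⟨h1, hs⟩), mul_assoc]
      exact hle.trans (Nat.le_mul_of_pos_right _ (Nat.mul_pos hg2 hg3))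
    by_cases hb : n < p
    · rw [if_pos (⟨hpp, hb⟩ : p.Prime ∧ n < p)]
      exact hle.trans (Nat.le_mul_of_pos_left _ (Nat.mul_pos hg1 hg2))
    by_cases ht : p ≤ 2 * n / 3
    · rw [if_pos (⟨hpp, ht⟩ : p.Prime ∧ p ≤ 2 * n / 3)]
      have : p ^ n.centralBinom.factorization p ≤ p :=
        (pow_right_mono₀ h1 (Nat.factorization_choose_le_one
          (Nat.sqrt_lt'.mp (not_le.1 hs)))).trans (pow_one p).le
      exact (this.trans (Nat.le_mul_of_pos_left _ hg1)).trans (Nat.le_mul_of_pos_right _ hg3)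
    · rw [Nat.factorization_centralBinom_of_two_mul_self_lt_three_mul hn (by lia) (by lia),
        pow_zero]
      exact Nat.mul_pos (Nat.mul_pos hg1 hg2) hg3
  refine (prod_le_prod' key).trans ?_
  rw [prod_mul_distrib, prod_mul_distrib]
  refine Nat.mul_le_mul (Nat.mul_le_mul ?_ ?_) ?_
  · rw [← prod_filter, prod_const]
    refine pow_right_mono₀ h2n ((card_le_card fun x hx => (mem_filter.1 hx).2).trans ?_)
    simp
  · rw [← prod_filter]
    refine le_trans (prod_le_prod_of_subset_of_one_le' ?_ ?_) (primorial_le_four_pow (2 * n / 3))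
    · intro p hp
      simp only [mem_filter, mem_range] at hp ⊢
      exact ⟨by lia, hp.2.1⟩
    · exact fun p hp _ => (mem_filter.1 hp).2.one_lt.le
  · rw [← prod_filter, prod_const]

theorem mem_primesIn {Q : ℝ} {q : ℕ} :
    q ∈ primesIn Q ↔ q.Prime ∧ Q ≤ (q : ℝ) ∧ (q : ℝ) < 2 * Q := by
  simp only [primesIn, Finset.mem_filter, Finset.mem_range, and_iff_right_iff_imp]
  rintro ⟨-, -, h⟩
  have := Nat.le_ceil (2 * Q)
  exact Nat.lt_succ_of_le (by exact_mod_cast (h.le.trans this))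

theorem card_primes_le_card_primesIn {Q : ℝ} {n : ℕ} (h1 : Q ≤ n + 1) (h2 : n < Q) :
    (Finset.card {p ∈ Finset.range (2 * n + 1) | p.Prime ∧ n < p}) ≤ (primesIn Q).card := by
  refine Finset.card_le_card fun p hp => ?_
  simp only [Finset.mem_filter, Finset.mem_range] at hp
  rw [mem_primesIn]
  have h3 : ((n + 1 : ℕ) : ℝ) ≤ p := by exact_mod_cast hp.2.2
  have h4 : (p : ℝ) ≤ (2 * n : ℕ) := by exact_mod_cast Nat.lt_succ_iff.1 hp.1
  push_cast at h3 h4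
  exact ⟨hp.2.1, by linarith, by linarith⟩

open Real in
theorem mul_log_four_le_card_primes (n : ℕ) (hn : 4 ≤ n) :
    n / 3 * log 4 ≤ (1 + √(2 * n) +
      (Finset.card {p ∈ Finset.range (2 * n + 1) | p.Prime ∧ n < p} : ℝ)) * log (2 * n) := by
  set k := Finset.card {p ∈ Finset.range (2 * n + 1) | p.Prime ∧ n < p} with hk
  have hb := centralBinom_le_pow_card_primes n (by lia)
  rw [← hk] at hb
  have h4 := (Nat.four_pow_lt_mul_centralBinom n hn).le
  have hn0 : (0 : ℝ) < n := by exact_mod_cast (by lia : 0 < n)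
  have h : (4 : ℝ) ^ n ≤ (2 * n) * ((2 * n) ^ (2 * n).sqrt * 4 ^ (2 * n / 3) * (2 * n) ^ k) := by
    have : 4 ^ n ≤ (2 * n) * ((2 * n) ^ (2 * n).sqrt * 4 ^ (2 * n / 3) * (2 * n) ^ k) :=
      h4.trans (Nat.mul_le_mul (by lia) hb)
    exact_mod_cast this
  have hlog : 0 ≤ log (2 * n) := log_nonneg (by
    have : (4 : ℝ) ≤ n := by exact_mod_cast hn
    linarith)
  have hx0 : (0 : ℝ) < 2 * n := by positivity
  have e2 : ((2 * n).sqrt : ℝ) ≤ √(2 * n) := by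
    refine Real.nat_sqrt_le_real_sqrt.trans ?_
    push_cast; rfl
  obtain ⟨x, hx⟩ : ∃ x : ℝ, x = 2 * n := ⟨_, rfl⟩
  rw [← hx] at h hlog hx0 e2 ⊢
  have hl := log_le_log (by positivity) h
  rw [log_mul (by positivity) (by positivity), log_mul (by positivity) (by positivity),
    log_mul (by positivity) (by positivity), log_pow, log_pow, log_pow, log_pow] at hl
  have hlog4 : 0 ≤ log 4 := log_nonneg (by norm_num)
  have e1 : ((2 * n / 3 : ℕ) : ℝ) ≤ 2 * n / 3 := by
    refine Nat.cast_div_le.trans ?_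
    push_cast; rfl
  have f1 := mul_le_mul_of_nonneg_right e1 hlog4
  have f2 := mul_le_mul_of_nonneg_right e2 hlog
  linarith

open Real Filter Asymptotics in
theorem eventually_rpow_le_card_primesIn {ε : ℝ} (hε : 0 < ε) :
    ∃ Q₀ : ℝ, 2 ≤ Q₀ ∧ ∀ Q : ℝ, Q₀ ≤ Q → Q / 24 ≤ (primesIn Q).card * Q ^ ε := by
  have o1 : ∀ᶠ x : ℝ in atTop, ‖log x‖ ≤ 1 / 2 * ‖x ^ ε‖ :=
    (isLittleO_log_rpow_atTop hε).bound (by norm_num)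
  have o2 : ∀ᶠ x : ℝ in atTop, ‖log x‖ ≤ 1 / 100 * ‖x ^ (1 / 2 : ℝ)‖ :=
    (isLittleO_log_rpow_atTop (by norm_num)).bound (by norm_num)
  obtain ⟨X, hX⟩ := (o1.and (o2.and (eventually_ge_atTop 10))).exists_forall_of_atTop
  refine ⟨max X 10, le_max_of_le_right (by norm_num), fun Q hQ => ?_⟩
  obtain ⟨h1, h2, h10⟩ := hX Q ((le_max_left _ _).trans hQ)
  have hQ0 : 0 < Q := by linarith
  have hlQ : 0 ≤ log Q := log_nonneg (by linarith)
  rw [norm_of_nonneg hlQ, norm_of_nonneg (by positivity)] at h1 h2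
  rw [← sqrt_eq_rpow] at h2
  obtain ⟨n, hn⟩ : ∃ n : ℕ, ⌈Q⌉₊ = n + 1 :=
    Nat.exists_eq_succ_of_ne_zero (Nat.ceil_pos.2 hQ0).ne'
  have hn1 : Q ≤ n + 1 := by
    have := Nat.le_ceil Q
    rw [hn] at this
    exact_mod_cast this
  have hn2 : n < Q := by
    have : n < ⌈Q⌉₊ := by lia
    exact Nat.lt_ceil.1 this
  have hn4 : 4 ≤ n := by
    have : (9 : ℝ) ≤ n := by linarith
    have : 9 ≤ n := by exact_mod_cast this
    lia
  have hm := mul_log_four_le_card_primes n hn4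
  have hc : ((Finset.card {p ∈ Finset.range (2 * n + 1) | p.Prime ∧ n < p} : ℕ) : ℝ) ≤
      (primesIn Q).card := by exact_mod_cast card_primes_le_card_primesIn hn1 hn2
  have hn0 : (0 : ℝ) < n := by linarith
  have hs : √(2 * n) ≤ 2 * √Q := by
    rw [sqrt_le_left (by positivity), mul_pow, sq_sqrt hQ0.le]
    linarith
  have hs1 : 1 ≤ √Q := one_le_sqrt.2 (by linarith)
  have hll : log (2 * n) ≤ 2 * log Q := by
    rw [← log_rpow hQ0]
    refine log_le_log (by positivity) ?_
    norm_cast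
    push_cast
    nlinarith
  have hll0 : 0 ≤ log (2 * n) := log_nonneg (by linarith)
  have hlog4 : 1 ≤ log 4 := by
    rw [le_log_iff_exp_le (by norm_num)]
    linarith [exp_one_lt_d9]
  set k : ℝ := ((primesIn Q).card : ℝ)
  have hk0 : 0 ≤ k := by positivity
  have a1 : (n : ℝ) / 3 ≤ n / 3 * log 4 := le_mul_of_one_le_right (by positivity) hlog4
  have a2 : (1 + √(2 * n) +
      (Finset.card {p ∈ Finset.range (2 * n + 1) | p.Prime ∧ n < p} : ℝ)) * log (2 * n) ≤
      (3 * √Q + k) * (2 * log Q) :=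
    mul_le_mul (by linarith) hll hll0 (by positivity)
  have a3 : √Q * log Q ≤ Q / 100 := by
    calc √Q * log Q ≤ √Q * (1 / 100 * √Q) := by gcongr
      _ = (√Q * √Q) / 100 := by ring
      _ = Q / 100 := by rw [mul_self_sqrt hQ0.le]
  have a4 : k * log Q ≤ k * (1 / 2 * Q ^ ε) := by gcongr
  linarith

theorem exists_inv_card_primesIn_le {ε : ℝ} (hε : 0 < ε) :
    ∃ C : ℝ, 0 ≤ C ∧ ∀ Q : ℝ, 2 ≤ Q → 1 / ((primesIn Q).card : ℝ) ≤ C * Q ^ ε / Q := by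
  obtain ⟨Q₀, hQ₀, h⟩ := eventually_rpow_le_card_primesIn hε
  refine ⟨Q₀ + 24, by linarith, fun Q hQ => ?_⟩
  have hQ0 : 0 < Q := by linarith
  have hQε : 1 ≤ Q ^ ε := Real.one_le_rpow (by linarith) hε.le
  rcases Nat.eq_zero_or_pos (primesIn Q).card with h0 | hpos
  · rw [h0, Nat.cast_zero, div_zero]
    positivity
  have hk : (1 : ℝ) ≤ (primesIn Q).card := by exact_mod_cast hpos
  rw [div_le_div_iff₀ (by linarith) hQ0]
  rcases le_total Q₀ Q with hle | hle
  · have := h Q hle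
    have : 0 ≤ Q₀ * Q ^ ε * (primesIn Q).card := by positivity
    linarith
  · have : Q₀ * 1 * 1 ≤ (Q₀ + 24) * Q ^ ε * (primesIn Q).card := by gcongr; linarith
    linarith

/-- The natural numbers in `[L, 2L)`. -/
noncomputable def dyadicBox (L : ℝ) : Finset ℕ := Finset.Ico ⌈L⌉₊ ⌈2 * L⌉₊

theorem mem_dyadicBox {L : ℝ} {l : ℕ} : l ∈ dyadicBox L ↔ L ≤ l ∧ (l : ℝ) < 2 * L := by
  rw [dyadicBox, Finset.mem_Ico, Nat.ceil_le, Nat.lt_ceil]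

theorem ceil_two_mul_le {L : ℝ} (hL : 1 ≤ L) : (⌈2 * L⌉₊ : ℝ) ≤ ⌈L⌉₊ + 2 * L := by
  have h1 := Nat.ceil_lt_add_one (by linarith : 0 ≤ 2 * L)
  have h2 := Nat.le_ceil L
  linarith

theorem card_dyadicBox_le {L : ℝ} (hL : 1 ≤ L) : ((dyadicBox L).card : ℝ) ≤ 2 * L := by
  have h : ⌈L⌉₊ ≤ ⌈2 * L⌉₊ := Nat.ceil_mono (by linarith)
  rw [dyadicBox, Nat.card_Ico, Nat.cast_sub h]
  linarith [ceil_two_mul_le hL]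

theorem card_dyadicBox_filter_residue_le {L Q : ℝ} {q : ℕ} (hQ : 0 < Q) (hL : 1 ≤ L) (hQL : Q ≤ L)
    (hq : Q ≤ q) (r : ZMod q) :
    (((dyadicBox L).filter fun l : ℕ => (l : ZMod q) = r).card : ℝ) ≤ 3 * L / Q := by
  have hq0 : (0 : ℝ) < q := by linarith
  have hq' : 0 < q := by exact_mod_cast hq0
  have : NeZero q := ⟨hq'.ne'⟩
  have hfil : ((dyadicBox L).filter fun l : ℕ => (l : ZMod q) = r) =
      (Finset.Ico ⌈L⌉₊ ⌈2 * L⌉₊).filter fun l => l ≡ r.val [MOD q] := by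
    ext l
    simp only [dyadicBox, Finset.mem_filter]
    rw [← ZMod.natCast_eq_natCast_iff, ZMod.natCast_zmod_val]
  have hcard := Nat.Ico_filter_modEq_card ⌈L⌉₊ ⌈2 * L⌉₊ hq' r.val
  rw [hfil, ← Int.cast_natCast (R := ℝ), hcard, Int.cast_max]
  refine max_le ?_ (by simp only [Int.cast_zero]; positivity)
  have c1 := Int.ceil_lt_add_one (((⌈2 * L⌉₊ : ℚ) - (r.val : ℚ)) / q)
  have c2 := Int.le_ceil (((⌈L⌉₊ : ℚ) - (r.val : ℚ)) / q)
  have c3 : (⌈((⌈2 * L⌉₊ : ℚ) - (r.val : ℚ)) / q⌉ - ⌈((⌈L⌉₊ : ℚ) - (r.val : ℚ)) / q⌉ : ℚ) ≤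
      ((⌈2 * L⌉₊ : ℚ) - ⌈L⌉₊) / q + 1 := by
    have : ((⌈2 * L⌉₊ : ℚ) - ⌈L⌉₊) / q =
      ((⌈2 * L⌉₊ : ℚ) - (r.val : ℚ)) / q - ((⌈L⌉₊ : ℚ) - (r.val : ℚ)) / q := by ring
    linarith
  have c4 : (⌈((⌈2 * L⌉₊ : ℚ) - (r.val : ℚ)) / q⌉ - ⌈((⌈L⌉₊ : ℚ) - (r.val : ℚ)) / q⌉ : ℝ) ≤
      ((⌈2 * L⌉₊ : ℝ) - ⌈L⌉₊) / q + 1 := by exact_mod_cast c3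
  push_cast
  refine c4.trans ?_
  have c5 := ceil_two_mul_le hL
  have c6 : ((⌈2 * L⌉₊ : ℝ) - ⌈L⌉₊) / q ≤ 2 * L / Q :=
    div_le_div₀ (by linarith) (by linarith) hQ hq
  have c7 : 1 ≤ L / Q := (one_le_div hQ).2 hQL
  have : 3 * L / Q = 2 * L / Q + L / Q := by ring
  linarith

/-- The residues of the first coordinate compatible with given second and third ones. -/
theorem exists_finset_residues {a : ℤ} (ha : a ≠ 0) (b c : ℤ) {d : ℕ} (hd : 1 ≤ d) {q : ℕ}
    [Fact q.Prime] (y z : ZMod q) :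
    ∃ R : Finset (ZMod q), R.card ≤ a.natAbs * d ∧ ∀ x : ZMod q,
      (∃ ul um un : (ZMod q)ˣ, (ul : ZMod q) = x ∧ (um : ZMod q) = y ∧ (un : ZMod q) = z ∧
        (ul ^ a * um ^ b * un ^ c) ^ (d : ℤ) = 1) → x ∈ R := by
  classical
  by_cases h : ∃ um un : (ZMod q)ˣ, (um : ZMod q) = y ∧ (un : ZMod q) = z
  swap
  · exact ⟨∅, by simp, fun x ⟨_, um, un, _, hm, hn, _⟩ => (h ⟨um, un, hm, hn⟩).elim⟩
  obtain ⟨vm, vn, hvm, hvn⟩ := h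
  have hpos : 0 < a.natAbs * d := Nat.mul_pos (Int.natAbs_pos.2 ha) hd
  obtain ⟨w, hw⟩ : ∃ w : (ZMod q)ˣ, ∀ u : (ZMod q)ˣ,
      (u ^ a * vm ^ b * vn ^ c) ^ (d : ℤ) = 1 → u ^ (a.natAbs * d) = w := by
    rcases Int.natAbs_eq a with e | e
    · refine ⟨((vm ^ b * vn ^ c) ^ d)⁻¹, fun u hu => ?_⟩
      rw [e, zpow_natCast, zpow_natCast, mul_assoc, mul_pow, ← pow_mul] at hu
      exact eq_inv_of_mul_eq_one_left hu
    · refine ⟨(vm ^ b * vn ^ c) ^ d, fun u hu => ?_⟩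
      rw [e, zpow_neg, zpow_natCast, zpow_natCast, mul_assoc, mul_pow, inv_pow, ← pow_mul] at hu
      exact (inv_mul_eq_one.1 hu)
  refine ⟨(Polynomial.nthRoots (a.natAbs * d) (w : ZMod q)).toFinset,
    (Multiset.toFinset_card_le _).trans (Polynomial.card_nthRoots _ _), ?_⟩
  rintro x ⟨ul, um, un, rfl, hm, hn, hu⟩
  obtain rfl : um = vm := Units.ext (hm.trans hvm.symm)
  obtain rfl : un = vn := Units.ext (hn.trans hvn.symm)
  rw [Multiset.mem_toFinset, Polynomial.mem_nthRoots hpos]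
  exact_mod_cast congrArg Units.val (hw ul hu)

open Finset in
theorem card_triples_le_of_fibers {S : Set (ℕ × ℕ × ℕ)} {A B D : Finset ℕ} {K : ℝ}
    (hS : ∀ p ∈ S, p.1 ∈ A ∧ p.2.1 ∈ B ∧ p.2.2 ∈ D)
    (hK : ∀ y z, ∃ F : Finset ℕ, (F.card : ℝ) ≤ K ∧ ∀ x, (x, y, z) ∈ S → x ∈ F) :
    (S.ncard : ℝ) ≤ K * (B.card * D.card) := by
  classical
  have hfin : S.Finite := ((A ×ˢ B ×ˢ D).finite_toSet).subset fun p hp => by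
    simpa using hS p hp
  choose F hF hmem using hK
  rw [Set.ncard_eq_toFinset_card S hfin]
  have hsub : hfin.toFinset ⊆ (B ×ˢ D).biUnion fun t => (F t.1 t.2) ×ˢ {t} := by
    rintro ⟨x, y, z⟩ hp
    rw [Set.Finite.mem_toFinset] at hp
    simp only [mem_biUnion, mem_product, mem_singleton]
    exact ⟨(y, z), (hS _ hp).2, hmem y z x hp, rfl⟩
  have h1 : (hfin.toFinset.card : ℝ) ≤ ∑ t ∈ B ×ˢ D, ((F t.1 t.2).card : ℝ) := by
    have := (card_le_card hsub).trans card_biUnion_le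
    simp only [card_product, card_singleton, mul_one] at this
    exact_mod_cast this
  refine (h1.trans (sum_le_card_nsmul _ _ K fun t _ => hF t.1 t.2)).trans ?_
  rw [card_product, nsmul_eq_mul]
  push_cast
  linarith

theorem Ncount_le_of_le_left {a : ℤ} (ha : a ≠ 0) (b c : ℤ) {d : ℕ} (hd : 1 ≤ d)
    {Q L M N : ℝ} {q : ℕ} (hQ : 2 ≤ Q) (hL : 1 ≤ L) (hM : 1 ≤ M) (hN : 1 ≤ N) (hq : q ∈ primesIn Q)
    (hQL : Q ≤ L) :
    (Ncount a b c d L M N q : ℝ) ≤ 12 * (a.natAbs * d) * (L * M * N) / Q := by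
  classical
  obtain ⟨hp, hq1, -⟩ := mem_primesIn.1 hq
  have := Fact.mk hp
  have hQ0 : 0 < Q := by linarith
  have key : (Ncount a b c d L M N q : ℝ) ≤ (a.natAbs * d * (3 * L / Q)) *
      ((dyadicBox M).card * (dyadicBox N).card) := by
    refine card_triples_le_of_fibers (A := dyadicBox L) ?_ fun y z => ?_
    · rintro p ⟨⟨h1, h2, h3⟩, -⟩
      exact ⟨mem_dyadicBox.2 h1, mem_dyadicBox.2 h2, mem_dyadicBox.2 h3⟩
    obtain ⟨R, hR, hmem⟩ := exists_finset_residues ha b c hd (y : ZMod q) (z : ZMod q)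
    refine ⟨R.biUnion fun r => (dyadicBox L).filter fun l : ℕ => (l : ZMod q) = r, ?_, ?_⟩
    · have h1 : (((R.biUnion fun r => (dyadicBox L).filter fun l : ℕ => (l : ZMod q) = r).card : ℕ)
          : ℝ) ≤ ∑ r ∈ R, (((dyadicBox L).filter fun l : ℕ => (l : ZMod q) = r).card : ℝ) := by
        exact_mod_cast Finset.card_biUnion_le
      refine (h1.trans (Finset.sum_le_card_nsmul _ _ _ fun r _ =>
        card_dyadicBox_filter_residue_le hQ0 hL hQL hq1 r)).trans ?_
      rw [nsmul_eq_mul]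
      have : (R.card : ℝ) ≤ a.natAbs * d := by exact_mod_cast hR
      gcongr
    · rintro x ⟨⟨h1, -⟩, -, h, -⟩
      simp only [Finset.mem_biUnion, Finset.mem_filter]
      exact ⟨x, hmem _ h, mem_dyadicBox.2 h1, rfl⟩
  calc (Ncount a b c d L M N q : ℝ) ≤ (a.natAbs * d * (3 * L / Q)) *
      ((dyadicBox M).card * (dyadicBox N).card) := key
    _ ≤ (a.natAbs * d * (3 * L / Q)) * ((2 * M) * (2 * N)) := by
      gcongr
      · exact card_dyadicBox_le hM
      · exact card_dyadicBox_le hN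
    _ = _ := by ring

theorem Ncount_swap_left (a b c : ℤ) (d : ℕ) (L M N : ℝ) (q : ℕ) :
    Ncount a b c d L M N q = Ncount b a c d M L N q := by
  let e : ℕ × ℕ × ℕ ≃ ℕ × ℕ × ℕ :=
    ⟨fun p => (p.2.1, p.1, p.2.2), fun p => (p.2.1, p.1, p.2.2), fun _ => rfl, fun _ => rfl⟩
  unfold Ncount
  rw [← Set.ncard_image_of_injective _ e.injective, e.image_eq_preimage_symm]
  congr 1
  ext ⟨l, m, n⟩
  simp only [Set.mem_preimage, Set.mem_ofPred_eq, e, Equiv.coe_fn_symm_mk]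
  rw [mul_comm m l, mul_comm ((m : ℚ) ^ a)]
  have : (∃ ul um un : (ZMod q)ˣ, (ul : ZMod q) = m ∧ (um : ZMod q) = l ∧ (un : ZMod q) = n ∧
      (ul ^ a * um ^ b * un ^ c) ^ (d : ℤ) = 1) ↔
      (∃ ul um un : (ZMod q)ˣ, (ul : ZMod q) = l ∧ (um : ZMod q) = m ∧ (un : ZMod q) = n ∧
      (ul ^ b * um ^ a * un ^ c) ^ (d : ℤ) = 1) := by
    constructor <;> rintro ⟨u, v, w, h1, h2, h3, h4⟩ <;>
      exact ⟨v, u, w, h2, h1, h3, by rwa [mul_comm (v ^ _)]⟩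
  rw [this]
  tauto

theorem Ncount_swap_right (a b c : ℤ) (d : ℕ) (L M N : ℝ) (q : ℕ) :
    Ncount a b c d L M N q = Ncount a c b d L N M q := by
  let e : ℕ × ℕ × ℕ ≃ ℕ × ℕ × ℕ :=
    ⟨fun p => (p.1, p.2.2, p.2.1), fun p => (p.1, p.2.2, p.2.1), fun _ => rfl, fun _ => rfl⟩
  unfold Ncount
  rw [← Set.ncard_image_of_injective _ e.injective, e.image_eq_preimage_symm]
  congr 1
  ext ⟨l, m, n⟩
  simp only [Set.mem_preimage, Set.mem_ofPred_eq, e, Equiv.coe_fn_symm_mk]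
  rw [mul_right_comm l n m, mul_right_comm ((l : ℚ) ^ a)]
  have : (∃ ul um un : (ZMod q)ˣ, (ul : ZMod q) = l ∧ (um : ZMod q) = n ∧ (un : ZMod q) = m ∧
      (ul ^ a * um ^ b * un ^ c) ^ (d : ℤ) = 1) ↔
      (∃ ul um un : (ZMod q)ˣ, (ul : ZMod q) = l ∧ (um : ZMod q) = m ∧ (un : ZMod q) = n ∧
      (ul ^ a * um ^ c * un ^ b) ^ (d : ℤ) = 1) := by
    constructor <;> rintro ⟨u, v, w, h1, h2, h3, h4⟩ <;>
      exact ⟨u, w, v, h1, h3, h2, by rwa [mul_right_comm]⟩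
  rw [this]
  exact and_congr_left fun _ => and_congr_right fun _ => and_comm

theorem Ncount_le_of_le_max {a b c : ℤ} (ha : a ≠ 0) (hb : b ≠ 0) (hc : c ≠ 0) {d : ℕ} (hd : 1 ≤ d)
    {Q L M N : ℝ} {q : ℕ} (hQ : 2 ≤ Q) (hL : 1 ≤ L) (hM : 1 ≤ M) (hN : 1 ≤ N) (hq : q ∈ primesIn Q)
    (h : Q ≤ L ∨ Q ≤ M ∨ Q ≤ N) :
    (Ncount a b c d L M N q : ℝ) ≤
      12 * ((a.natAbs + b.natAbs + c.natAbs : ℕ) * d) * (L * M * N) / Q := by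
  have hQ0 : 0 < Q := by linarith
  rcases h with h | h | h
  · refine (Ncount_le_of_le_left ha b c hd hQ hL hM hN hq h).trans ?_
    gcongr
    lia
  · rw [Ncount_swap_left]
    refine (Ncount_le_of_le_left hb a c hd hQ hM hL hN hq h).trans ?_
    rw [mul_comm M L]
    gcongr
    lia
  · rw [Ncount_swap_right, Ncount_swap_left]
    refine (Ncount_le_of_le_left hc a b hd hQ hN hL hM hq h).trans ?_
    rw [mul_comm N L, mul_right_comm L N M]
    gcongr
    lia

/-- An integer of size at most `Q ^ k` has at most `k` prime divisors in `[Q, 2Q)`. -/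
theorem card_primesIn_dvd_le {Q : ℝ} (hQ : 2 ≤ Q) {D : ℕ} (hD : D ≠ 0) {k : ℕ}
    (hk : (D : ℝ) ≤ Q ^ k) {T : Finset ℕ} (hT : T ⊆ primesIn Q) (hdvd : ∀ q ∈ T, q ∣ D) :
    T.card ≤ k := by
  have h1 : ∏ q ∈ T, q ∣ D :=
    Finset.prod_primes_dvd D (fun q hq => (mem_primesIn.1 (hT hq)).1.prime) hdvd
  have h2 : Q ^ T.card ≤ ((∏ q ∈ T, q : ℕ) : ℝ) := by
    rw [← Finset.prod_const]
    push_cast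
    exact Finset.prod_le_prod (fun _ _ => by linarith) fun q hq => (mem_primesIn.1 (hT hq)).2.1
  have h3 : ((∏ q ∈ T, q : ℕ) : ℝ) ≤ D := by exact_mod_cast Nat.le_of_dvd (by lia) h1
  exact (pow_le_pow_iff_right₀ (by linarith)).1 ((h2.trans h3).trans hk)

theorem zpow_eq_toNat_div {G : Type*} [Group G] (x : G) (a : ℤ) :
    x ^ a = x ^ a.toNat / x ^ (-a).toNat := by
  rw [← zpow_natCast, ← zpow_natCast, div_eq_mul_inv, ← zpow_sub, Int.toNat_sub_toNat_neg]

theorem zpow_eq_toNat_div₀ {G : Type*} [GroupWithZero G] {x : G} (hx : x ≠ 0) (a : ℤ) :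
    x ^ a = x ^ a.toNat / x ^ (-a).toNat := by
  rw [← zpow_natCast, ← zpow_natCast, ← zpow_sub₀ hx, Int.toNat_sub_toNat_neg]

/-- A nonzero integer of controlled size divisible by every modulus counted at `(l, m, n)`. -/
theorem exists_nat_dvd_of_mem (a b c : ℤ) {d : ℕ} (hd : 1 ≤ d) {Q : ℝ} (hQ : 2 ≤ Q) {l m n : ℕ}
    (hl : 0 < l) (hm : 0 < m) (hn : 0 < n) (hlQ : (l : ℝ) ≤ 2 * Q) (hmQ : (m : ℝ) ≤ 2 * Q)
    (hnQ : (n : ℝ) ≤ 2 * Q) (hne : (l : ℚ) ^ a * (m : ℚ) ^ b * (n : ℚ) ^ c ≠ 1) :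
    ∃ D : ℕ, D ≠ 0 ∧ (D : ℝ) ≤ Q ^ (2 * ((a.natAbs + b.natAbs + c.natAbs) * d)) ∧ ∀ q : ℕ,
      (∃ ul um un : (ZMod q)ˣ, (ul : ZMod q) = (l : ZMod q) ∧ (um : ZMod q) = (m : ZMod q) ∧
        (un : ZMod q) = (n : ZMod q) ∧ (ul ^ a * um ^ b * un ^ c) ^ (d : ℤ) = 1) → q ∣ D := by
  set A : ℕ := l ^ a.toNat * m ^ b.toNat * n ^ c.toNat with hA
  set B : ℕ := l ^ (-a).toNat * m ^ (-b).toNat * n ^ (-c).toNat with hB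
  have hlq : (l : ℚ) ≠ 0 := by exact_mod_cast hl.ne'
  have hmq : (m : ℚ) ≠ 0 := by exact_mod_cast hm.ne'
  have hnq : (n : ℚ) ≠ 0 := by exact_mod_cast hn.ne'
  have hAB : A ≠ B := by
    intro h
    apply hne
    rw [zpow_eq_toNat_div₀ hlq, zpow_eq_toNat_div₀ hmq, zpow_eq_toNat_div₀ hnq,
      div_mul_div_comm, div_mul_div_comm, div_eq_one_iff_eq (by positivity)]
    exact_mod_cast h
  have hABd : A ^ d ≠ B ^ d := fun h => hAB (Nat.pow_left_injective (by lia) h)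
  have hbound : ∀ i j k : ℕ, i ≤ a.natAbs → j ≤ b.natAbs → k ≤ c.natAbs →
      (((l ^ i * m ^ j * n ^ k) ^ d : ℕ) : ℝ) ≤
        Q ^ (2 * ((a.natAbs + b.natAbs + c.natAbs) * d)) := by
    intro i j k hi hj hk
    have h2Q : 2 * Q ≤ Q ^ 2 := by nlinarith
    push_cast
    calc ((l : ℝ) ^ i * m ^ j * n ^ k) ^ d ≤ ((2 * Q) ^ i * (2 * Q) ^ j * (2 * Q) ^ k) ^ d := by
          gcongr
      _ = (2 * Q) ^ ((i + j + k) * d) := by rw [← pow_add, ← pow_add, ← pow_mul]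
      _ ≤ (2 * Q) ^ ((a.natAbs + b.natAbs + c.natAbs) * d) :=
          pow_le_pow_right₀ (by linarith) (by gcongr)
      _ ≤ (Q ^ 2) ^ ((a.natAbs + b.natAbs + c.natAbs) * d) := by gcongr
      _ = _ := by rw [← pow_mul]
  have hA' := hbound a.toNat b.toNat c.toNat (by lia) (by lia) (by lia)
  have hB' := hbound (-a).toNat (-b).toNat (-c).toNat (by lia) (by lia) (by lia)
  rw [← hA] at hA'
  rw [← hB] at hB'
  refine ⟨((A ^ d : ℕ) - (B ^ d : ℕ) : ℤ).natAbs, by lia, ?_, ?_⟩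
  · have : ((A ^ d : ℕ) - (B ^ d : ℕ) : ℤ).natAbs ≤ max (A ^ d) (B ^ d) := by lia
    have h' : ((((A ^ d : ℕ) - (B ^ d : ℕ) : ℤ).natAbs : ℕ) : ℝ) ≤ ((max (A ^ d) (B ^ d) : ℕ) : ℝ) :=
      by exact_mod_cast this
    refine h'.trans ?_
    rw [Nat.cast_max]
    exact max_le hA' hB'
  · rintro q ⟨ul, um, un, h1, h2, h3, h⟩
    rw [← Int.natCast_dvd, ← ZMod.intCast_zmod_eq_zero_iff_dvd]
    rw [zpow_eq_toNat_div ul, zpow_eq_toNat_div um, zpow_eq_toNat_div un, div_mul_div_comm,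
      div_mul_div_comm, zpow_natCast, div_pow, div_eq_one] at h
    have h' := congrArg Units.val h
    push_cast at h'
    rw [h1, h2, h3] at h'
    rw [Int.cast_sub, sub_eq_zero, hA, hB]
    push_cast
    exact h'

open Finset in
theorem sum_Ncount_le_of_lt (a b c : ℤ) {d : ℕ} (hd : 1 ≤ d) {Q L M N : ℝ} (hQ : 2 ≤ Q)
    (hL : 1 ≤ L) (hM : 1 ≤ M) (hN : 1 ≤ N) (hLQ : L ≤ Q) (hMQ : M ≤ Q) (hNQ : N ≤ Q) :
    ∑ q ∈ primesIn Q, (Ncount a b c d L M N q : ℝ) ≤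
      16 * ((a.natAbs + b.natAbs + c.natAbs : ℕ) * d) * (L * M * N) := by
  classical
  set P : ℕ → ℕ × ℕ × ℕ → Prop := fun q p =>
    (∃ ul um un : (ZMod q)ˣ, (ul : ZMod q) = (p.1 : ZMod q) ∧
      (um : ZMod q) = (p.2.1 : ZMod q) ∧ (un : ZMod q) = (p.2.2 : ZMod q) ∧
      (ul ^ a * um ^ b * un ^ c) ^ (d : ℤ) = 1) ∧
    (p.1 : ℚ) ^ a * (p.2.1 : ℚ) ^ b * (p.2.2 : ℚ) ^ c ≠ 1 with hP
  set X := dyadicBox L ×ˢ dyadicBox M ×ˢ dyadicBox N with hX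
  have h1 : ∀ q, Ncount a b c d L M N q ≤ #(X.bipartiteAbove P q) := by
    intro q
    rw [← Set.ncard_coe_finset]
    refine Set.ncard_le_ncard ?_ (Finset.finite_toSet _)
    rintro p ⟨⟨h1, h2, h3⟩, -, h4⟩
    simp only [coe_bipartiteAbove, Set.mem_ofPred_eq, hX, mem_product, mem_dyadicBox]
    exact ⟨⟨h1, h2, h3⟩, h4⟩
  have h2 : ∀ p ∈ X, #((primesIn Q).bipartiteBelow P p) ≤
      2 * ((a.natAbs + b.natAbs + c.natAbs) * d) := by
    rintro ⟨l, m, n⟩ hp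
    simp only [hX, mem_product, mem_dyadicBox] at hp
    obtain ⟨⟨l1, l2⟩, ⟨m1, m2⟩, n1, n2⟩ := hp
    by_cases hne : (l : ℚ) ^ a * (m : ℚ) ^ b * (n : ℚ) ^ c ≠ 1
    swap
    · refine (Nat.le_zero.2 (card_eq_zero.2 ?_)).trans (Nat.zero_le _)
      exact filter_false_of_mem fun q _ h => hne h.2
    have pos : ∀ {x : ℕ} {y : ℝ}, 1 ≤ y → y ≤ x → 0 < x := fun h h' =>
      Nat.cast_pos (α := ℝ).1 (by linarith)
    obtain ⟨D, hD, hDle, hdvd⟩ := exists_nat_dvd_of_mem a b c hd hQ (pos hL l1) (pos hM m1)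
      (pos hN n1) (by linarith) (by linarith) (by linarith) hne
    exact card_primesIn_dvd_le hQ hD hDle (filter_subset _ _) fun q hq =>
      hdvd q (mem_filter.1 hq).2.1
  have h3 : ∑ q ∈ primesIn Q, Ncount a b c d L M N q ≤
      #X * (2 * ((a.natAbs + b.natAbs + c.natAbs) * d)) := by
    refine (sum_le_sum fun q _ => h1 q).trans ?_
    rw [sum_card_bipartiteAbove_eq_sum_card_bipartiteBelow]
    exact sum_le_card_nsmul _ _ _ h2
  have h4 : (#X : ℝ) ≤ (2 * L) * ((2 * M) * (2 * N)) := by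
    rw [hX, card_product, card_product]
    push_cast
    gcongr
    · exact card_dyadicBox_le hL
    · exact card_dyadicBox_le hM
    · exact card_dyadicBox_le hN
  calc ∑ q ∈ primesIn Q, (Ncount a b c d L M N q : ℝ)
      ≤ #X * (2 * ((a.natAbs + b.natAbs + c.natAbs : ℕ) * d)) := by exact_mod_cast h3
    _ ≤ ((2 * L) * ((2 * M) * (2 * N))) * (2 * ((a.natAbs + b.natAbs + c.natAbs : ℕ) * d)) := by
      gcongr
    _ = _ := by ring

/-- Conjecture `𝒫(a,b,c,d)` holds on average over primes `q ∈ [Q, 2Q)`. -/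
theorem conjectureP_on_average
    (a b c : ℤ) (ha : a ≠ 0) (hb : b ≠ 0) (hc : c ≠ 0)
    (hcop : Int.gcd a (Int.gcd b c) = 1) (d : ℕ) (hd : 1 ≤ d) :
    ∀ ε : ℝ, 0 < ε → ∃ C : ℝ, 0 ≤ C ∧ ∀ Q : ℝ, 2 ≤ Q → ∀ L M N : ℝ,
      1 ≤ L → 1 ≤ M → 1 ≤ N →
        (1 / ((primesIn Q).card : ℝ)) *
            ∑ q ∈ primesIn Q, (Ncount a b c d L M N q : ℝ) ≤
          C * Q ^ ε * (L * M * N) / Q := by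
  intro ε hε
  obtain ⟨C₀, hC₀, hcard⟩ := exists_inv_card_primesIn_le hε
  set K : ℝ := (a.natAbs + b.natAbs + c.natAbs : ℕ) * d with hK
  have hK0 : 0 ≤ K := by positivity
  refine ⟨12 * K + 16 * K * C₀, by positivity, fun Q hQ L M N hL hM hN => ?_⟩
  have hQ0 : 0 < Q := by linarith
  have hQε : 1 ≤ Q ^ ε := Real.one_le_rpow (by linarith) hε.le
  have hV : 0 ≤ L * M * N := by positivity
  by_cases h : Q ≤ L ∨ Q ≤ M ∨ Q ≤ N
  · have hsum := Finset.sum_le_card_nsmul (primesIn Q) (fun q => (Ncount a b c d L M N q : ℝ)) _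
      fun q hq => Ncount_le_of_le_max ha hb hc hd hQ hL hM hN hq h
    rw [← hK, nsmul_eq_mul] at hsum
    have hB : 0 ≤ 12 * K * (L * M * N) / Q := by positivity
    calc (1 / ((primesIn Q).card : ℝ)) * ∑ q ∈ primesIn Q, (Ncount a b c d L M N q : ℝ)
        ≤ (1 / ((primesIn Q).card : ℝ)) * ((primesIn Q).card * (12 * K * (L * M * N) / Q)) := by
          gcongr
      _ = ((primesIn Q).card / (primesIn Q).card : ℝ) * (12 * K * (L * M * N) / Q) := by ring
      _ ≤ 1 * (12 * K * (L * M * N) / Q) := by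
          gcongr
          exact div_self_le_one _
      _ = (12 * K + 0) * 1 * (L * M * N) / Q := by ring
      _ ≤ _ := by
          gcongr
          positivity
  · push Not at h
    calc (1 / ((primesIn Q).card : ℝ)) * ∑ q ∈ primesIn Q, (Ncount a b c d L M N q : ℝ)
        ≤ (C₀ * Q ^ ε / Q) * (16 * K * (L * M * N)) :=
          mul_le_mul (hcard Q hQ)
            (sum_Ncount_le_of_lt a b c hd hQ hL hM hN h.1.le h.2.1.le h.2.2.le)
            (by positivity) (by positivity)
      _ = (0 + 16 * K * C₀) * Q ^ ε * (L * M * N) / Q := by ring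
      _ ≤ _ := by
          gcongr
          positivity
end

section
/- Let a, b, c be positive integers with 1 ≤ a ≤ b and gcd(a, b, c) = 1, and set n = max(a+b, c) − gcd(a, c) − gcd(b, c) + 1. Assume a + b ≠ c and a + b ≡ c (mod 2). Then n = 4 if and only if (a, b, c) is one of (1,2,5), (1,4,1), (1,4,3), (1,6,3), (2,3,1), (3,4,3), or (a = 4, b = c with c > 4 odd). -/
/-- Numerical data `a = g x`, `b = h y`, `c = g h z` with `max (a + b) c = g + h + 3` are bounded,
apart from the family `a = 4`, `b = c`. -/
theorem bounded_or_eq_of_max_eq {g h x y z : ℕ} (hg : 0 < g) (hh : 0 < h) (hx : 0 < x)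
    (hy : 0 < y) (hz : 0 < z) (hab : g * x ≤ h * y) (hne : g * x + h * y ≠ g * h * z)
    (hpar : (g * x + h * y) % 2 = (g * h * z) % 2)
    (hmax : max (g * x + h * y) (g * h * z) = g + h + 3) :
    (h * y ≤ 10 ∧ g * h * z ≤ 12) ∨ (g = 1 ∧ g * x = 4 ∧ h * y = g * h * z) := by
  obtain ⟨x, rfl⟩ : ∃ k, x = k + 1 := ⟨x - 1, by omega⟩
  obtain ⟨y, rfl⟩ : ∃ k, y = k + 1 := ⟨y - 1, by omega⟩
  have hgh : g * h ≤ g * h * z := Nat.le_mul_of_pos_right _ hz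
  rcases lt_or_gt_of_ne hne with hlt | hlt
  · rw [max_eq_right hlt.le] at hmax
    left
    suffices g * h * z ≤ 10 by omega
    rcases Nat.lt_or_ge g 2 with hg' | hg'
    · obtain rfl : g = 1 := by omega
      have : h ∣ 4 := by
        rw [one_mul] at hmax
        exact (Nat.dvd_add_right (dvd_refl h)).1 ⟨z, by omega⟩
      have := Nat.le_of_dvd (by norm_num) this
      omega
    · rcases Nat.lt_or_ge h 2 with hh' | hh'
      · obtain rfl : h = 1 := by omega
        have : g ∣ 4 := by
          rw [mul_one] at hmax
          exact (Nat.dvd_add_right (dvd_refl g)).1 ⟨z, by omega⟩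
        have := Nat.le_of_dvd (by norm_num) this
        omega
      · suffices g + h ≤ 7 by omega
        nlinarith
  · rw [max_eq_left hlt.le] at hmax
    have hsum : g * x + h * y = 3 := by linarith
    have hc : g * h * z ≤ g + h + 1 := by omega
    rcases Nat.eq_zero_or_pos y with rfl | hy'
    · have hg3 : g ∣ 3 := ⟨x, by omega⟩
      rcases (Nat.dvd_prime Nat.prime_three).1 hg3 with rfl | rfl
      · right
        obtain rfl : x = 3 := by omega
        refine ⟨rfl, rfl, ?_⟩
        rcases Nat.lt_or_ge z 2 with hz' | hz'
        · obtain rfl : z = 1 := by omega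
          ring
        · nlinarith
      · omega
    · have := Nat.le_mul_of_pos_right h hy'
      have := Nat.zero_le (g * x)
      left
      constructor <;> linarith

/-- The list of solutions among the finitely many triples with `b ≤ 10` and `c ≤ 12`. -/
theorem mem_of_max_eq_of_le :
    ∀ (a b : Fin 11) (c : Fin 13), ((a : ℕ) ≤ b ∧ 1 ≤ (a : ℕ) ∧ 1 ≤ (c : ℕ) ∧
        Nat.gcd a (Nat.gcd b c) = 1 ∧ (a + b : ℕ) ≠ c ∧ (a + b : ℕ) % 2 = c % 2 ∧
        max (a + b : ℕ) c = Nat.gcd a c + Nat.gcd b c + 3) →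
      ((a : ℕ), (b : ℕ), (c : ℕ)) ∈ [(1, 2, 5), (1, 4, 1), (1, 4, 3), (1, 6, 3), (2, 3, 1),
        (3, 4, 3), (4, 5, 5), (4, 7, 7), (4, 9, 9)] := by
  decide +kernel

/-- for positive integers `1 ≤ a ≤ b`, `c ≥ 1` with `gcd(a,b,c) = 1`,
`a + b ≠ c` and `a + b ≡ c (mod 2)`, the quantity
`n = max(a+b, c) - gcd(a,c) - gcd(b,c) + 1` equals `4` iff `(a,b,c)` is one of
`(1,2,5), (1,4,1), (1,4,3), (1,6,3), (2,3,1), (3,4,3)`, or `a = 4` and `b = c` with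
`c > 4` odd. -/
theorem hypergeometric_rank_four_classification
    (a b c : ℕ) (ha : 1 ≤ a) (hab : a ≤ b) (hc : 1 ≤ c)
    (hcop : Nat.gcd a (Nat.gcd b c) = 1)
    (hne : a + b ≠ c) (hpar : (a + b) % 2 = c % 2) :
    ((max (a + b) c : ℕ) : ℤ) - (Nat.gcd a c : ℤ) - (Nat.gcd b c : ℤ) + 1 = 4 ↔
      ((a, b, c) = (1, 2, 5) ∨ (a, b, c) = (1, 4, 1) ∨ (a, b, c) = (1, 4, 3) ∨
        (a, b, c) = (1, 6, 3) ∨ (a, b, c) = (2, 3, 1) ∨ (a, b, c) = (3, 4, 3) ∨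
        (a = 4 ∧ b = c ∧ 4 < c ∧ Odd c)) := by
  constructor
  · intro hn
    have hmax : max (a + b) c = Nat.gcd a c + Nat.gcd b c + 3 := by omega
    by_cases hbd : b ≤ 10 ∧ c ≤ 12
    · have hmem := mem_of_max_eq_of_le ⟨a, by omega⟩ ⟨b, by omega⟩ ⟨c, by omega⟩
        ⟨hab, ha, hc, hcop, hne, hpar, hmax⟩
      simp only [List.mem_cons, List.not_mem_nil, or_false, Prod.mk.injEq] at hmem
      rcases hmem with h | h | h | h | h | h | h | h | h <;>
      · obtain ⟨rfl, rfl, rfl⟩ := h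
        decide
    have hcop' : Nat.Coprime (Nat.gcd a c) (Nat.gcd b c) :=
      Nat.Coprime.of_dvd_left (Nat.gcd_dvd_left a c) hcop
    obtain ⟨z, hz⟩ :=
      hcop'.mul_dvd_of_dvd_of_dvd (Nat.gcd_dvd_right a c) (Nat.gcd_dvd_right b c)
    obtain ⟨x, hx⟩ := Nat.gcd_dvd_left a c
    obtain ⟨y, hy⟩ := Nat.gcd_dvd_left b c
    have hg : 0 < Nat.gcd a c := Nat.gcd_pos_of_pos_left _ ha
    have hh : 0 < Nat.gcd b c := Nat.gcd_pos_of_pos_right _ hc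
    generalize Nat.gcd a c = g at *
    generalize Nat.gcd b c = h at *
    have key := bounded_or_eq_of_max_eq (x := x) (y := y) (z := z) hg hh
      (Nat.pos_of_ne_zero (by rintro rfl; omega)) (Nat.pos_of_ne_zero (by rintro rfl; omega))
      (Nat.pos_of_ne_zero (by rintro rfl; omega))
    rw [← hx, ← hy, ← hz] at key
    rcases key hab hne hpar hmax with hle | ⟨rfl, h4, hbc⟩
    · exact absurd hle hbd
    · obtain rfl : b = c := hbc
      subst h4
      have hodd : Odd b := by
        obtain rfl : h = b := by omega
        exact Nat.coprime_two_left.1 (Nat.Coprime.of_dvd_left (by norm_num) hcop)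
      iterate 6 right
      exact ⟨rfl, rfl, by omega, hodd⟩
  · rintro (h | h | h | h | h | h | ⟨rfl, rfl, h, hodd⟩)
    iterate 6
      · simp only [Prod.mk.injEq] at h
        obtain ⟨rfl, rfl, rfl⟩ := h
        decide
    have h4 : Nat.gcd 4 b = 1 := Nat.Coprime.pow_left 2 (Nat.coprime_two_left.2 hodd)
    rw [h4, Nat.gcd_self, max_eq_left (by omega)]
    push_cast
    ring
end

section
/- Let a ≥ 1 be an integer, let k be a finite field such that a divides |k^×|, and let ψ : k → ℂ^× be a nontrivial additive character. Then for every u ∈ k^×: −Σ_{x ∈ k^×, x^a = u} ψ(a·x) = ε_a(ψ) · |k|^{−(a−1)/2} · Σ_{(x_ρ)_{ρ∈R_a} ∈ (k^×)^{R_a}, ∏_{ρ∈R_a} x_ρ = u} ψ(Σ_{ρ∈R_a} x_ρ) · ∏_{ρ∈R_a} ρ(x_ρ). -/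
open scoped Classical

/-- The normalized Gauss sum `ε(ψ,χ) = |k|^{-1/2} ∑_{x ∈ k^×} ψ(x) χ(x)`. -/
noncomputable def gaussEps {k : Type*} [Field k] [Fintype k]
    (ψ : AddChar k ℂ) (χ : MulChar k ℂ) : ℂ :=
  (Fintype.card k : ℂ) ^ (-(1 / 2 : ℂ)) * ∑ x : kˣ, ψ (x : k) * χ (x : k)

/-- `ε_a(ψ) = |k|^{-1/2} ∏_{ρ^a = 1} ε(ψ,ρ)^{-1}`. -/
noncomputable def epsA {k : Type*} [Field k] [Fintype k] (a : ℕ) (ψ : AddChar k ℂ) : ℂ :=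
  (Fintype.card k : ℂ) ^ (-(1 / 2 : ℂ)) *
    ∏ᶠ ρ : {ρ : MulChar k ℂ // ρ ^ a = 1}, (gaussEps ψ ρ.1)⁻¹

section PolynomialLFunction

open Polynomial

variable (k : Type*) [Field k] [Fintype k]

/-- The monic polynomials of degree `n` over a finite field. -/
noncomputable def monicsOfDegree (n : ℕ) : Finset k[X] :=
  Set.Finite.toFinset (s := {f : k[X] | f.Monic ∧ f.natDegree = n}) <| by
    have : Finite (degreeLT k (n + 1)) := Finite.of_equiv _ (degreeLTEquiv k (n + 1)).toEquiv.symm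
    refine Set.Finite.subset (Set.toFinite (degreeLT k (n + 1) : Set k[X])) fun f hf => ?_
    rw [SetLike.mem_coe, mem_degreeLT, degree_eq_natDegree hf.1.ne_zero, hf.2]
    exact_mod_cast Nat.lt_succ_self n

/-- The monic irreducible polynomials of degree at most `n` over a finite field. -/
noncomputable def monicPrimes (n : ℕ) : Finset k[X] :=
  ((Finset.range (n + 1)).biUnion (monicsOfDegree k)).filter Irreducible

variable {k}

lemma mem_monicsOfDegree {n : ℕ} {f : k[X]} :
    f ∈ monicsOfDegree k n ↔ f.Monic ∧ f.natDegree = n := by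
  simp [monicsOfDegree]

lemma mem_monicPrimes {n : ℕ} {f : k[X]} :
    f ∈ monicPrimes k n ↔ f.Monic ∧ f.natDegree ≤ n ∧ Irreducible f := by
  simp only [monicPrimes, Finset.mem_filter, Finset.mem_biUnion, Finset.mem_range,
    mem_monicsOfDegree]
  grind

/-- The `n`-th coefficient of the `L`-series of a completely multiplicative function. -/
noncomputable def lCoeff (Λ : k[X] →* ℂ) (n : ℕ) : ℂ := ∑ f ∈ monicsOfDegree k n, Λ f

/-- The sum over prime powers of degree `m`, weighted by the degree of the prime. -/
noncomputable def primePowerSum (Λ : k[X] →* ℂ) (m : ℕ) : ℂ :=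
  ∑ P ∈ monicPrimes k m, if P.natDegree ∣ m then P.natDegree * Λ P ^ (m / P.natDegree) else 0

lemma primePowerSum_eq (Λ : k[X] →* ℂ) {m N : ℕ} (hm : 1 ≤ m) (hN : m ≤ N) :
    primePowerSum Λ m = ∑ P ∈ monicPrimes k N, ∑ j ∈ Finset.Icc 1 N,
      if j * P.natDegree = m then P.natDegree * Λ P ^ j else 0 := by
  have hsub : monicPrimes k m ⊆ monicPrimes k N := fun P hP => by
    rw [mem_monicPrimes] at hP ⊢; exact ⟨hP.1, hP.2.1.trans hN, hP.2.2⟩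
  rw [primePowerSum, Finset.sum_subset hsub]
  · refine Finset.sum_congr rfl fun P hP => ?_
    have hd : 0 < P.natDegree := (mem_monicPrimes.1 hP).2.2.natDegree_pos
    split_ifs with h
    · obtain ⟨j, rfl⟩ := h
      have hj : 1 ≤ j := Nat.pos_of_ne_zero fun h => by simp [h] at hm
      rw [Finset.sum_eq_single j]
      · rw [if_pos (mul_comm _ _), Nat.mul_div_cancel_left _ hd]
      · intro i _ hi
        rw [if_neg]
        rw [mul_comm P.natDegree]
        exact fun h => hi (Nat.eq_of_mul_eq_mul_right hd h)
      · intro h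
        exact absurd (Finset.mem_Icc.2 ⟨hj, (Nat.le_mul_of_pos_left j hd).trans hN⟩) h
    · rw [Finset.sum_eq_zero]
      intro j _
      rw [if_neg]
      rintro rfl
      exact h (dvd_mul_left _ _)
  · intro P hP hP'
    rw [if_neg]
    intro h
    rw [mem_monicPrimes] at hP hP'
    exact hP' ⟨hP.1, Nat.le_of_dvd hm h, hP.2.2⟩

lemma sum_filter_pow_dvd (Λ : k[X] →* ℂ) {P : k[X]} (hP : P.Monic) (j n : ℕ)
    (hn : j * P.natDegree ≤ n) :
    ∑ f ∈ monicsOfDegree k n with P ^ j ∣ f, Λ f = Λ P ^ j * lCoeff Λ (n - j * P.natDegree) := by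
  rw [lCoeff, Finset.mul_sum]
  symm
  refine Finset.sum_bij (fun f _ => P ^ j * f) ?_ ?_ ?_ ?_
  · intro f hf
    rw [mem_monicsOfDegree] at hf
    rw [Finset.mem_filter, mem_monicsOfDegree]
    refine ⟨⟨(hP.pow j).mul hf.1, ?_⟩, dvd_mul_right _ _⟩
    rw [(hP.pow j).natDegree_mul hf.1, hP.natDegree_pow, hf.2]
    omega
  · intro f _ g _ h
    exact mul_left_cancel₀ (hP.pow j).ne_zero h
  · intro f hf
    rw [Finset.mem_filter, mem_monicsOfDegree] at hf
    obtain ⟨⟨hf, hd⟩, g, rfl⟩ := hf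
    have hg : g.Monic := (hP.pow j).of_mul_monic_left hf
    refine ⟨g, ?_, rfl⟩
    rw [mem_monicsOfDegree]
    refine ⟨hg, ?_⟩
    rw [(hP.pow j).natDegree_mul hg, hP.natDegree_pow] at hd
    omega
  · intro f _
    rw [map_mul, map_pow]

lemma sum_natDegree_mul_card_pow_dvd {n : ℕ} {f : k[X]} (hf : f ∈ monicsOfDegree k n) :
    ∑ P ∈ monicPrimes k n, P.natDegree * ((Finset.Icc 1 n).filter (P ^ · ∣ f)).card = n := by
  obtain ⟨hm, hd⟩ := mem_monicsOfDegree.1 hf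
  have hcard : ∀ P ∈ monicPrimes k n, ((Finset.Icc 1 n).filter (P ^ · ∣ f)).card =
      (UniqueFactorizationMonoid.normalizedFactors f).count P := by
    intro P hP
    obtain ⟨hPm, -, hPi⟩ := mem_monicPrimes.1 hP
    have hle : ∀ j, P ^ j ∣ f ↔ j ≤ (UniqueFactorizationMonoid.normalizedFactors f).count P := by
      intro j
      rw [pow_dvd_iff_le_emultiplicity,
        UniqueFactorizationMonoid.emultiplicity_eq_count_normalizedFactors hPi hm.ne_zero,
        hPm.normalize_eq_self, Nat.cast_le]
    have : (Finset.Icc 1 n).filter (P ^ · ∣ f) = Finset.Icc 1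
        ((UniqueFactorizationMonoid.normalizedFactors f).count P) := by
      ext j
      simp only [Finset.mem_filter, Finset.mem_Icc, hle]
      refine ⟨fun h => ⟨h.1.1, h.2⟩, fun h => ⟨⟨h.1, ?_⟩, h.2⟩⟩
      have := natDegree_le_of_dvd ((hle j).2 h.2) hm.ne_zero
      rw [hPm.natDegree_pow, hd] at this
      exact (Nat.le_mul_of_pos_right j hPi.natDegree_pos).trans this
    rw [this, Nat.card_Icc]
    simp
  rw [Finset.sum_congr rfl fun P hP => by rw [hcard P hP]]
  have hfac : ∀ P ∈ UniqueFactorizationMonoid.normalizedFactors f, P.Monic ∧ Irreducible P :=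
    fun P hP => ⟨by
      have := UniqueFactorizationMonoid.normalize_normalized_factor P hP
      rw [← this]
      exact monic_normalize
        (UniqueFactorizationMonoid.irreducible_of_normalized_factor P hP).ne_zero,
      UniqueFactorizationMonoid.irreducible_of_normalized_factor P hP⟩
  have hprod : (UniqueFactorizationMonoid.normalizedFactors f).prod = f := by
    rw [UniqueFactorizationMonoid.prod_normalizedFactors_eq hm.ne_zero, hm.normalize_eq_self]
  have hdeg := natDegree_multiset_prod_of_monic _ fun P hP => (hfac P hP).1
  rw [hprod, hd, Finset.sum_multiset_map_count] at hdeg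
  refine Eq.trans ?_ hdeg.symm
  symm
  refine Finset.sum_subset_zero_on_sdiff ?_ ?_ ?_
  · intro P hP
    rw [Multiset.mem_toFinset] at hP
    rw [mem_monicPrimes]
    refine ⟨(hfac P hP).1, ?_, (hfac P hP).2⟩
    rw [← hd]
    exact natDegree_le_of_dvd (UniqueFactorizationMonoid.dvd_of_mem_normalizedFactors hP) hm.ne_zero
  · intro P hP
    rw [Finset.mem_sdiff, Multiset.mem_toFinset] at hP
    rw [Multiset.count_eq_zero_of_notMem hP.2, mul_zero]
  · intro P _
    rw [smul_eq_mul, mul_comm]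

lemma natCast_mul_lCoeff (Λ : k[X] →* ℂ) (n : ℕ) :
    n * lCoeff Λ n = ∑ m ∈ Finset.Icc 1 n, primePowerSum Λ m * lCoeff Λ (n - m) := by
  have h1 : ∀ m ∈ Finset.Icc 1 n, primePowerSum Λ m * lCoeff Λ (n - m) =
      ∑ P ∈ monicPrimes k n, ∑ j ∈ Finset.Icc 1 n,
        if j * P.natDegree = m then P.natDegree * (Λ P ^ j * lCoeff Λ (n - j * P.natDegree))
          else 0 := by
    intro m hm
    rw [Finset.mem_Icc] at hm
    rw [primePowerSum_eq Λ hm.1 hm.2, Finset.sum_mul]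
    refine Finset.sum_congr rfl fun P _ => ?_
    rw [Finset.sum_mul]
    refine Finset.sum_congr rfl fun j _ => ?_
    split_ifs with h
    · rw [h]; ring
    · ring
  rw [Finset.sum_congr rfl h1, Finset.sum_comm]
  have h2 : ∀ P ∈ monicPrimes k n, (∑ m ∈ Finset.Icc 1 n, ∑ j ∈ Finset.Icc 1 n,
        if j * P.natDegree = m then P.natDegree * (Λ P ^ j * lCoeff Λ (n - j * P.natDegree))
          else 0) = ∑ j ∈ Finset.Icc 1 n, ∑ f ∈ monicsOfDegree k n,
            if P ^ j ∣ f then P.natDegree * Λ f else 0 := by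
    intro P hP
    obtain ⟨hPm, -, hPi⟩ := mem_monicPrimes.1 hP
    rw [Finset.sum_comm]
    refine Finset.sum_congr rfl fun j hj => ?_
    rw [Finset.sum_ite_eq, ← Finset.sum_filter, ← Finset.mul_sum]
    split_ifs with h
    · rw [sum_filter_pow_dvd Λ hPm j n (Finset.mem_Icc.1 h).2]
    · rw [Finset.sum_eq_zero, mul_zero]
      intro f hf
      exfalso
      rw [Finset.mem_filter, mem_monicsOfDegree] at hf
      refine h (Finset.mem_Icc.2 ⟨Nat.mul_pos (Finset.mem_Icc.1 hj).1 hPi.natDegree_pos, ?_⟩)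
      have := natDegree_le_of_dvd hf.2 hf.1.1.ne_zero
      rwa [hPm.natDegree_pow, hf.1.2] at this
  rw [Finset.sum_congr rfl h2, lCoeff, Finset.mul_sum]
  simp_rw [Finset.sum_comm (s := Finset.Icc 1 n)]
  rw [Finset.sum_comm]
  refine Finset.sum_congr rfl fun f hf => ?_
  conv_lhs => rw [← sum_natDegree_mul_card_pow_dvd hf]
  rw [Nat.cast_sum, Finset.sum_mul]
  refine Finset.sum_congr rfl fun P _ => ?_
  rw [← Finset.sum_filter, Finset.sum_const, nsmul_eq_mul]
  push_cast
  ring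

lemma lCoeff_zero (Λ : k[X] →* ℂ) : lCoeff Λ 0 = 1 := by
  have : monicsOfDegree k 0 = {1} := by
    ext f
    rw [mem_monicsOfDegree, Finset.mem_singleton]
    exact ⟨fun h => h.1.natDegree_eq_zero.1 h.2, by rintro rfl; simp⟩
  rw [lCoeff, this, Finset.sum_singleton, map_one]

lemma primePowerSum_zero (Λ : k[X] →* ℂ) : primePowerSum Λ 0 = 0 := by
  refine Finset.sum_eq_zero fun P hP => ?_
  have := mem_monicPrimes.1 hP
  exact absurd this.2.2.natDegree_pos (by omega)

lemma X_mul_derivative_lSeries (Λ : k[X] →* ℂ) :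
    PowerSeries.X * PowerSeries.derivative ℂ (PowerSeries.mk (lCoeff Λ)) =
      PowerSeries.mk (primePowerSum Λ) * PowerSeries.mk (lCoeff Λ) := by
  ext n
  symm
  rw [PowerSeries.coeff_mul, Finset.Nat.sum_antidiagonal_eq_sum_range_succ_mk,
    Finset.range_eq_Ico, Finset.sum_eq_sum_Ico_succ_bot (Nat.succ_pos n)]
  simp only [PowerSeries.coeff_mk, primePowerSum_zero, zero_mul, zero_add]
  have := natCast_mul_lCoeff Λ n
  rw [← Finset.Ico_add_one_right_eq_Icc] at this
  refine this.symm.trans ?_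
  cases n with
  | zero => simp
  | succ n =>
    rw [PowerSeries.coeff_succ_X_mul, PowerSeries.coeff_derivative]
    simp [mul_comm]

lemma PowerSeries.eq_of_X_mul_derivative_eq {f g s : PowerSeries ℂ}
    (hs : PowerSeries.constantCoeff s = 0)
    (hfg : PowerSeries.constantCoeff f = PowerSeries.constantCoeff g)
    (hf : PowerSeries.X * PowerSeries.derivative ℂ f = s * f)
    (hg : PowerSeries.X * PowerSeries.derivative ℂ g = s * g) : f = g := by
  obtain ⟨t, rfl⟩ := PowerSeries.X_dvd_iff.2 hs
  rw [mul_assoc] at hf hg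
  replace hf := mul_left_cancel₀ PowerSeries.X_ne_zero hf
  replace hg := mul_left_cancel₀ PowerSeries.X_ne_zero hg
  ext n
  induction n using Nat.strong_induction_on with
  | _ n ih =>
    cases n with
    | zero => simpa using hfg
    | succ n =>
      have h1 := congrArg (PowerSeries.coeff n) hf
      have h2 := congrArg (PowerSeries.coeff n) hg
      rw [PowerSeries.coeff_derivative, PowerSeries.coeff_mul] at h1 h2
      have h3 : (n : ℂ) + 1 ≠ 0 := by exact_mod_cast Nat.succ_ne_zero n
      refine mul_right_cancel₀ h3 (h1.trans (Eq.trans ?_ h2.symm))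
      refine Finset.sum_congr rfl fun p hp => ?_
      rw [ih p.2 (by have := Finset.HasAntidiagonal.mem_antidiagonal.1 hp; omega)]

lemma PowerSeries.X_mul_derivative_prod {ι : Type*} (I : Finset ι) (f s : ι → PowerSeries ℂ)
    (h : ∀ i ∈ I, PowerSeries.X * PowerSeries.derivative ℂ (f i) = s i * f i) :
    PowerSeries.X * PowerSeries.derivative ℂ (∏ i ∈ I, f i) = (∑ i ∈ I, s i) * ∏ i ∈ I, f i := by
  induction I using Finset.induction_on with
  | empty => simp
  | insert i I hi ih =>
    rw [Finset.prod_insert hi, Finset.sum_insert hi, Derivation.leibniz, smul_eq_mul, smul_eq_mul]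
    have h1 := h i (Finset.mem_insert_self i I)
    have h2 := ih fun j hj => h j (Finset.mem_insert_of_mem hj)
    linear_combination (∏ j ∈ I, f j) * h1 + f i * h2

/-- A completely multiplicative function on `k[X]` is determined up to its `L`-series by its sums
over prime powers. -/
lemma lSeries_eq_prod {ι : Type*} [Fintype ι] (Λ : k[X] →* ℂ) (Λ' : ι → k[X] →* ℂ)
    (h : ∀ m, 1 ≤ m → primePowerSum Λ m = ∑ i, primePowerSum (Λ' i) m) :
    PowerSeries.mk (lCoeff Λ) = ∏ i, PowerSeries.mk (lCoeff (Λ' i)) := by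
  refine PowerSeries.eq_of_X_mul_derivative_eq (s := PowerSeries.mk (primePowerSum Λ)) ?_ ?_
    (X_mul_derivative_lSeries Λ) ?_
  · rw [← PowerSeries.coeff_zero_eq_constantCoeff_apply, PowerSeries.coeff_mk, primePowerSum_zero]
  · rw [map_prod]
    simp_rw [← PowerSeries.coeff_zero_eq_constantCoeff_apply, PowerSeries.coeff_mk, lCoeff_zero]
    simp
  · rw [PowerSeries.X_mul_derivative_prod _ _ (fun i => PowerSeries.mk (primePowerSum (Λ' i)))
      fun i _ => X_mul_derivative_lSeries (Λ' i)]
    congr 1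
    ext m
    rw [map_sum]
    simp_rw [PowerSeries.coeff_mk]
    rcases Nat.eq_zero_or_pos m with rfl | hm
    · simp [primePowerSum_zero]
    · rw [h m hm]

variable {L : Type*} [Field L] [Fintype L] [Algebra k L]

lemma card_filter_minpoly_eq {P : k[X]} (hP : P.Monic) (hi : Irreducible P)
    (hd : P.natDegree ∣ Module.finrank k L) :
    (Finset.univ.filter fun y : L => minpoly k y = P).card = P.natDegree := by
  have hsplit : (P.map (algebraMap k L)).Splits := by
    have hdvd := hi.natDegree_dvd_iff_dvd_X_pow_card_pow_sub_X.1 hd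
    have hc : Nat.card k ^ Module.finrank k L = Fintype.card L := by
      rw [Module.card_eq_pow_finrank (K := k), Nat.card_eq_fintype_card]
    rw [hc] at hdvd
    refine Splits.of_dvd ?_ ?_ (Polynomial.map_dvd (algebraMap k L) hdvd)
    · exact (FiniteField.isSplittingField_sub L k).splits
    · rw [Polynomial.map_ne_zero_iff (algebraMap k L).injective]
      exact FiniteField.X_pow_card_sub_X_ne_zero k Fintype.one_lt_card
  rw [← card_rootSet_eq_natDegree (PerfectField.separable_of_irreducible hi) hsplit,
    ← Set.toFinset_card]
  congr 1
  ext y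
  rw [Finset.mem_filter, Set.mem_toFinset, mem_rootSet]
  refine ⟨?_, fun h => ⟨Finset.mem_univ _, (minpoly.eq_of_irreducible_of_monic hi h.2 hP).symm⟩⟩
  rintro ⟨-, rfl⟩
  exact ⟨hi.ne_zero, minpoly.aeval k y⟩

lemma primePowerSum_eq_sum_field (Λ : k[X] →* ℂ) :
    primePowerSum Λ (Module.finrank k L) =
      ∑ y : L, Λ (minpoly k y) ^ (Module.finrank k L / (minpoly k y).natDegree) := by
  have hint : ∀ y : L, IsIntegral k y := fun y => Algebra.IsIntegral.isIntegral y
  rw [← Finset.sum_fiberwise_of_maps_to (s := Finset.univ)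
    (t := monicPrimes k (Module.finrank k L)) (g := fun y : L => minpoly k y), primePowerSum]
  · refine Finset.sum_congr rfl fun P hP => ?_
    obtain ⟨hPm, -, hPi⟩ := mem_monicPrimes.1 hP
    rw [Finset.sum_congr rfl (g := fun _ => Λ P ^ (Module.finrank k L / P.natDegree))
      fun y hy => by rw [(Finset.mem_filter.1 hy).2], Finset.sum_const, nsmul_eq_mul]
    split_ifs with h
    · rw [card_filter_minpoly_eq hPm hPi h]
    · rw [Finset.filter_eq_empty_iff.2, Finset.card_empty, Nat.cast_zero, zero_mul]
      rintro y - rfl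
      exact h (minpoly.degree_dvd (hint y))
  · intro y _
    rw [mem_monicPrimes]
    exact ⟨minpoly.monic (hint y), minpoly.natDegree_le y, minpoly.irreducible (hint y)⟩

omit [Fintype k] in
lemma eval_minpoly_pow (c : k) (y : L) :
    (minpoly k y).eval c ^ (Module.finrank k L / (minpoly k y).natDegree) =
      Algebra.norm k (algebraMap k L c - y) := by
  have hint : IsIntegral k y := Algebra.IsIntegral.isIntegral y
  have htower : Module.finrank k L / (minpoly k y).natDegree =
      Module.finrank (IntermediateField.adjoin k {y}) L := by
    rw [← Module.finrank_mul_finrank k (IntermediateField.adjoin k {y}) L,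
      IntermediateField.adjoin.finrank hint, Nat.mul_div_cancel_left _ (minpoly.natDegree_pos hint)]
  have hgen : algebraMap k L c - y = algebraMap (IntermediateField.adjoin k {y}) L
      (algebraMap k _ c - IntermediateField.AdjoinSimple.gen k y) := by
    rw [map_sub, IntermediateField.AdjoinSimple.algebraMap_gen, ← IsScalarTower.algebraMap_apply]
  rw [htower, hgen, ← Algebra.norm_norm (S := IntermediateField.adjoin k {y}),
    Algebra.norm_algebraMap, map_pow]
  congr 1
  let pb := IntermediateField.adjoin.powerBasis hint
  have hpb : pb.gen = IntermediateField.AdjoinSimple.gen k y :=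
    IntermediateField.adjoin.powerBasis_gen hint
  rw [← IntermediateField.minpoly_gen k y, ← hpb, ← charpoly_leftMulMatrix pb,
    Matrix.eval_charpoly, Algebra.norm_eq_matrix_det pb.basis, map_sub]
  congr 2
  ext i j
  simp [Matrix.scalar_apply, Matrix.diagonal_apply, Matrix.algebraMap_matrix_apply]

end PolynomialLFunction

section CharacterSums

open Polynomial

variable {k : Type*} [Field k] [Fintype k]

/-- The multiplicative character `ρ` extended to `0` by `1` if `ρ` is trivial. -/
noncomputable def extendByOne (ρ : MulChar k ℂ) : k →* ℂ := if ρ = 1 then 1 else ρ.toMonoidHom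

lemma extendByOne_coe (ρ : MulChar k ℂ) (z : kˣ) : extendByOne ρ (z : k) = ρ z := by
  rw [extendByOne]
  split_ifs with h
  · simp [h]
  · rfl

lemma extendByOne_zero (ρ : MulChar k ℂ) : extendByOne ρ 0 = if ρ = 1 then 1 else 0 := by
  rw [extendByOne]
  split_ifs with h
  · rfl
  · exact MulChar.map_zero ρ

instance hasEnoughRootsOfUnity_exponent_units :
    HasEnoughRootsOfUnity ℂ (Monoid.exponent kˣ) :=
  have : NeZero (Monoid.exponent kˣ) := ⟨Monoid.exponent_ne_zero_of_finite⟩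
  inferInstance

noncomputable instance MulChar.fintypeComplex : Fintype (MulChar k ℂ) := Fintype.ofFinite _

lemma card_mulChar_pow_eq_one {a : ℕ} (hak : a ∣ Fintype.card kˣ) :
    Fintype.card {ρ : MulChar k ℂ // ρ ^ a = 1} = a := by
  obtain ⟨e⟩ := MulChar.mulEquiv_units k ℂ
  have h := IsCyclic.card_powMonoidHom_ker kˣ a
  rw [Nat.card_eq_fintype_card (α := kˣ), Nat.gcd_eq_right hak] at h
  refine Nat.card_eq_fintype_card.symm.trans (Eq.trans ?_ h)
  refine Nat.card_congr (e.toEquiv.subtypeEquiv fun ρ => ?_)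
  rw [MonoidHom.mem_ker, powMonoidHom_apply]
  change _ ↔ e ρ ^ a = 1
  rw [← map_pow, map_eq_one_iff e e.injective]

lemma exists_pow_eq_iff_of_dvd_card {G : Type*} [CommGroup G] [Finite G] [IsCyclic G] {a : ℕ}
    (ha : a ∣ Nat.card G) (t : G) : (∃ y, y ^ a = t) ↔ t ^ (Nat.card G / a) = 1 := by
  have hpos : 0 < Nat.card G := Nat.card_pos
  constructor
  · rintro ⟨y, rfl⟩
    rw [← pow_mul, Nat.mul_div_cancel' ha, pow_card_eq_one']
  · intro h
    obtain ⟨g, hg⟩ := IsCyclic.exists_generator (α := G)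
    obtain ⟨i, rfl⟩ := (isOfFinOrder_of_finite g).mem_zpowers_iff_mem_range_orderOf.1 (hg t) |>
      Finset.mem_image.1 |> fun ⟨i, _, hi⟩ => (⟨i, hi⟩ : ∃ i, g ^ i = t)
    rw [← pow_mul, ← orderOf_dvd_iff_pow_eq_one, orderOf_eq_card_of_forall_mem_zpowers hg] at h
    obtain ⟨b, hb⟩ := ha
    have ha0 : 0 < a := Nat.pos_of_ne_zero fun h => by simp [h] at hb; omega
    have hb0 : 0 < b := Nat.pos_of_ne_zero fun h => by simp [h] at hb; omega
    rw [hb, Nat.mul_div_cancel_left _ ha0] at h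
    obtain ⟨j, rfl⟩ := Nat.dvd_of_mul_dvd_mul_right hb0 h
    exact ⟨g ^ j, by rw [← pow_mul, mul_comm]⟩

lemma sum_mulChar_pow_eq_one {a : ℕ} (hak : a ∣ Fintype.card kˣ) (z : kˣ) :
    ∑ ρ : {ρ : MulChar k ℂ // ρ ^ a = 1}, ρ.1 (z : k) = if ∃ y, y ^ a = z then (a : ℂ) else 0 := by
  have hiff := exists_pow_eq_iff_of_dvd_card (by rwa [Nat.card_eq_fintype_card]) z (a := a)
  rw [Nat.card_eq_fintype_card] at hiff
  by_cases h : z ^ (Fintype.card kˣ / a) = 1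
  · rw [if_pos (hiff.2 h)]
    obtain ⟨y, rfl⟩ := hiff.2 h
    rw [Finset.sum_congr rfl (g := fun _ => 1), Finset.sum_const, Finset.card_univ,
      card_mulChar_pow_eq_one hak, nsmul_eq_mul, mul_one]
    rintro ⟨ρ, hρ⟩ -
    rw [Units.val_pow_eq_pow_val, map_pow, ← MulChar.pow_apply_coe, hρ, MulChar.one_apply_coe]
  · rw [if_neg fun h' => h (hiff.1 h')]
    have h' : (z : k) ^ (Fintype.card kˣ / a) ≠ 1 :=
      fun h' => h (Units.ext (by simpa using h'))
    obtain ⟨χ, hχ⟩ := MulChar.exists_apply_ne_one_of_hasEnoughRootsOfUnity k ℂ h'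
    let ρ₀ : {ρ : MulChar k ℂ // ρ ^ a = 1} := ⟨χ ^ (Fintype.card kˣ / a), by
      rw [← pow_mul, Nat.div_mul_cancel hak]
      exact χ.pow_card_eq_one⟩
    have hρ₀ : ρ₀.1 z ≠ 1 := by
      rwa [MulChar.pow_apply_coe, ← map_pow]
    refine eq_zero_of_mul_eq_self_left hρ₀ ?_
    rw [Finset.mul_sum]
    refine Fintype.sum_bijective (fun ρ => ⟨ρ₀.1 * ρ.1, by rw [mul_pow, ρ₀.2, ρ.2, mul_one]⟩)
      ?_ _ _ fun ρ => (MulChar.mul_apply _ _ _).symm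
    refine Finite.injective_iff_bijective.1 fun ρ σ h => ?_
    exact Subtype.ext (mul_left_cancel (Subtype.ext_iff.1 h))

lemma exists_isPrimitiveRoot_of_dvd_card {a : ℕ} (hak : a ∣ Fintype.card kˣ) :
    ∃ ζ : k, IsPrimitiveRoot ζ a := by
  obtain ⟨g, hg⟩ := IsCyclic.exists_generator (α := kˣ)
  have h := IsPrimitiveRoot.orderOf g
  rw [orderOf_eq_card_of_forall_mem_zpowers hg, Nat.card_eq_fintype_card] at h
  obtain ⟨b, hb⟩ := hak
  exact ⟨_, IsPrimitiveRoot.coe_units_iff.2 (h.pow Fintype.card_pos (hb.trans (mul_comm _ _)))⟩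

variable {L : Type*} [Field L] [Fintype L] [Algebra k L]

lemma card_pow_eq_eq_sum_norm {a : ℕ} (ha : 1 ≤ a) (hak : a ∣ Fintype.card kˣ) (t : L) :
    ((Finset.univ.filter fun y : L => y ^ a = t).card : ℂ) =
      ∑ ρ : {ρ : MulChar k ℂ // ρ ^ a = 1}, extendByOne ρ.1 (Algebra.norm k t) := by
  obtain ⟨ζ, hζ⟩ := exists_isPrimitiveRoot_of_dvd_card hak
  have hζL := hζ.map_of_injective (algebraMap k L).injective
  by_cases ht : t = 0
  · subst ht
    have : (Finset.univ.filter fun y : L => y ^ a = 0) = {0} := by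
      ext y
      simp [show a ≠ 0 by omega]
    rw [this, Finset.card_singleton, Algebra.norm_zero]
    simp_rw [extendByOne_zero]
    rw [Finset.sum_eq_single ⟨1, one_pow a⟩]
    · simp
    · rintro ⟨ρ, hρ⟩ - h
      exact if_neg fun h' => h (Subtype.ext h')
    · simp
  · have hN : Algebra.norm k t ≠ 0 := Algebra.norm_ne_zero_iff.2 ht
    have hsum := sum_mulChar_pow_eq_one hak (Units.mk0 _ hN)
    have h1 : ∀ ρ : {ρ : MulChar k ℂ // ρ ^ a = 1}, extendByOne ρ.1 (Algebra.norm k t) =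
        ρ.1 (Units.mk0 _ hN : kˣ) := fun ρ => extendByOne_coe ρ.1 (Units.mk0 _ hN)
    rw [Finset.sum_congr rfl fun ρ _ => h1 ρ, hsum]
    have hcard : (Finset.univ.filter fun y : L => y ^ a = t) = (nthRoots a t).toFinset := by
      ext y
      simp [mem_nthRoots (show 0 < a by omega)]
    rw [hcard, Multiset.toFinset_card_of_nodup (hζL.nthRoots_nodup ht), hζL.card_nthRoots,
      Nat.cast_ite, Nat.cast_zero]
    have hq : 1 < Fintype.card k := Fintype.one_lt_card
    have hdvd : Fintype.card k - 1 ∣ Fintype.card L - 1 := by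
      rw [Module.card_eq_pow_finrank (K := k) (V := L)]
      exact Nat.sub_one_dvd_pow_sub_one _ _
    have hakL : a ∣ Nat.card Lˣ := by
      rw [Nat.card_eq_fintype_card, Fintype.card_units]
      rw [Fintype.card_units] at hak
      exact hak.trans hdvd
    refine ite_congr (propext ?_) (fun _ => rfl) fun _ => rfl
    rw [exists_pow_eq_iff_of_dvd_card (by rwa [Nat.card_eq_fintype_card])]
    have hL : (∃ α : L, α ^ a = t) ↔ ∃ y : Lˣ, y ^ a = Units.mk0 t ht := by
      constructor
      · rintro ⟨α, hα⟩
        refine ⟨Units.mk0 α ?_, Units.ext hα⟩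
        rintro rfl
        exact ht (by rw [← hα, zero_pow (by omega)])
      · rintro ⟨y, hy⟩
        exact ⟨y, by simpa using congrArg Units.val hy⟩
    rw [hL, exists_pow_eq_iff_of_dvd_card hakL, Units.ext_iff, Units.ext_iff,
      ← (algebraMap k L).injective.eq_iff]
    simp only [Units.val_pow_eq_pow_val, Units.val_mk0, Units.val_one, map_pow, map_one,
      FiniteField.algebraMap_norm_eq_pow, ← pow_mul]
    have : (Nat.card L - 1) / (Nat.card k - 1) * (Nat.card kˣ / a) = Nat.card Lˣ / a := by
      simp only [Nat.card_eq_fintype_card, Fintype.card_units] at hak hakL ⊢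
      rw [← Nat.mul_div_assoc _ hak, Nat.div_mul_cancel hdvd]
    rw [this]

end CharacterSums

section HasseDavenport

open Polynomial

variable {k : Type*} [Field k] [Fintype k]

/-- The completely multiplicative function `f ↦ φ (f(c))` on polynomials. -/
noncomputable def evalChar (φ : k →* ℂ) (c : k) : k[X] →* ℂ :=
  φ.comp (evalRingHom c : k[X] →+* k).toMonoidHom

omit [Fintype k] in
lemma evalChar_apply (φ : k →* ℂ) (c : k) (f : k[X]) : evalChar φ c f = φ (f.eval c) := rfl

variable {L : Type*} [Field L] [Fintype L] [Algebra k L]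

omit [Fintype k] in
lemma evalChar_minpoly_pow (φ : k →* ℂ) (c : k) (y : L) :
    evalChar φ c (minpoly k y) ^ (Module.finrank k L / (minpoly k y).natDegree) =
      φ (Algebra.norm k (algebraMap k L c - y)) := by
  rw [evalChar_apply, ← map_pow, eval_minpoly_pow]

lemma primePowerSum_evalChar_mul (φ φ' : k →* ℂ) :
    primePowerSum (evalChar φ (-1) * evalChar φ' 0) (Module.finrank k L) =
      ∑ t : L, φ (Algebra.norm k (t - 1)) * φ' (Algebra.norm k t) := by
  rw [primePowerSum_eq_sum_field (L := L), ← Equiv.sum_comp (Equiv.neg L)]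
  refine Finset.sum_congr rfl fun t _ => ?_
  rw [MonoidHom.mul_apply, mul_pow, evalChar_minpoly_pow, evalChar_minpoly_pow, Equiv.neg_apply]
  congr 3
  · rw [map_neg, map_one]; ring
  · rw [map_zero]; ring

lemma primePowerSum_prod_evalChar {a : ℕ} (ha : 1 ≤ a) {ζ : k} (hζ : IsPrimitiveRoot ζ a)
    (φ : k →* ℂ) :
    primePowerSum (∏ z ∈ nthRootsFinset a (1 : k), evalChar φ (-z)) (Module.finrank k L) =
      ∑ y : L, φ (Algebra.norm k (y ^ a - 1)) := by
  rw [primePowerSum_eq_sum_field (L := L), ← Equiv.sum_comp (Equiv.neg L)]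
  refine Finset.sum_congr rfl fun y _ => ?_
  rw [MonoidHom.finsetProd_apply, ← Finset.prod_pow]
  simp_rw [evalChar_minpoly_pow]
  rw [← map_prod, ← map_prod]
  congr 2
  have h := congrArg (aeval y) (X_pow_sub_one_eq_prod ha hζ)
  simp only [map_sub, map_pow, aeval_X, map_one, map_prod, aeval_C] at h
  rw [h]
  refine Finset.prod_congr rfl fun z _ => ?_
  rw [Equiv.neg_apply, map_neg]
  ring

lemma lSeries_prod_evalChar {a : ℕ} (ha : 1 ≤ a) (hak : a ∣ Fintype.card kˣ) {ζ : k}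
    (hζ : IsPrimitiveRoot ζ a) (φ : k →* ℂ) :
    PowerSeries.mk (lCoeff (∏ z ∈ nthRootsFinset a (1 : k), evalChar φ (-z))) =
      ∏ ρ : {ρ : MulChar k ℂ // ρ ^ a = 1},
        PowerSeries.mk (lCoeff (evalChar φ (-1) * evalChar (extendByOne ρ.1) 0)) := by
  refine lSeries_eq_prod _ _ fun m hm => ?_
  obtain ⟨p, hp⟩ := CharP.exists k
  have : Fact p.Prime := ⟨CharP.char_is_prime k p⟩
  have : NeZero m := ⟨by omega⟩
  let _ : Fintype (FiniteField.Extension k p m) := Fintype.ofFinite _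
  rw [← FiniteField.finrank_extension k p m, primePowerSum_prod_evalChar ha hζ]
  simp_rw [primePowerSum_evalChar_mul]
  rw [Finset.sum_comm]
  simp_rw [← Finset.mul_sum, ← card_pow_eq_eq_sum_norm ha hak]
  rw [← Finset.sum_fiberwise (s := Finset.univ) (g := fun y => y ^ a)]
  refine Finset.sum_congr rfl fun t _ => ?_
  rw [Finset.sum_congr rfl (g := fun _ => φ (Algebra.norm k (t - 1)))
    fun y hy => by rw [(Finset.mem_filter.1 hy).2], Finset.sum_const, nsmul_eq_mul, mul_comm]

lemma add_mem_monicsOfDegree {n : ℕ} {f g : k[X]} (hf : f ∈ monicsOfDegree k n)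
    (hg : g.degree < n) : f + g ∈ monicsOfDegree k n := by
  rw [mem_monicsOfDegree] at hf ⊢
  have h : g.degree < f.degree := by
    rwa [degree_eq_natDegree hf.1.ne_zero, hf.2]
  exact ⟨hf.1.add_of_left h, (natDegree_add_eq_left_of_degree_lt h).trans hf.2⟩

lemma lCoeff_eq_zero_of_shift {χ : MulChar k ℂ} (hχ : χ ≠ 1) (ψ : k →* ℂ) {n : ℕ} {g : k[X]}
    (hg : g.degree < n) (hg1 : g.eval (-1) ≠ 0)
    (hg0 : ∀ (c : k) (f : k[X]), ψ ((f + C c * g).eval 0) = ψ (f.eval 0)) :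
    lCoeff (evalChar χ.toMonoidHom (-1) * evalChar ψ 0) n = 0 := by
  have hshift : ∀ c : k, lCoeff (evalChar χ.toMonoidHom (-1) * evalChar ψ 0) n =
      ∑ f ∈ monicsOfDegree k n, χ (f.eval (-1) + c * g.eval (-1)) * ψ (f.eval 0) := by
    intro c
    symm
    have hdeg : ∀ c : k, (C c * g).degree < n := fun c =>
      (degree_mul_le _ _).trans_lt <| (add_le_add_left degree_C_le _).trans_lt (by rwa [zero_add])
    refine Finset.sum_bij (fun f _ => f + C c * g) (fun f hf => add_mem_monicsOfDegree hf (hdeg c))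
      (fun _ _ _ _ h => add_right_cancel h) (fun f hf => ⟨f + C (-c) * g,
        add_mem_monicsOfDegree hf (hdeg _), by rw [C_neg]; ring⟩) fun f hf => ?_
    rw [MonoidHom.mul_apply, evalChar_apply, evalChar_apply, hg0]
    simp
  have hsum : ∑ c : k, lCoeff (evalChar χ.toMonoidHom (-1) * evalChar ψ 0) n = 0 := by
    rw [Finset.sum_congr rfl fun c _ => hshift c, Finset.sum_comm]
    refine Finset.sum_eq_zero fun f _ => ?_
    rw [← Finset.sum_mul]
    convert zero_mul _
    rw [← MulChar.sum_eq_zero_of_ne_one hχ]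
    exact Fintype.sum_equiv ((Equiv.mulRight₀ _ hg1).trans (Equiv.addLeft (f.eval (-1)))) _ _
      fun c => rfl
  rw [Finset.sum_const, Finset.card_univ, nsmul_eq_mul, mul_eq_zero] at hsum
  exact hsum.resolve_left (by exact_mod_cast Fintype.card_ne_zero)

lemma lSeries_evalChar_mul {χ : MulChar k ℂ} (hχ : χ ≠ 1) (ρ : MulChar k ℂ) :
    PowerSeries.mk (lCoeff (evalChar χ.toMonoidHom (-1) * evalChar (extendByOne ρ) 0)) =
      if ρ = 1 then 1 else 1 + PowerSeries.C (χ (-1) * jacobiSum χ ρ) * PowerSeries.X := by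
  have h2 : ∀ n, lCoeff (evalChar χ.toMonoidHom (-1) * evalChar (extendByOne ρ) 0) (n + 2) = 0 :=
    fun n => lCoeff_eq_zero_of_shift hχ _ (g := X)
      (by rw [degree_X]; exact_mod_cast (by omega : 1 < n + 2)) (by simp) (by simp)
  split_ifs with h
  · ext n
    rw [PowerSeries.coeff_mk, PowerSeries.coeff_one]
    rcases n with _ | _ | n
    · rw [lCoeff_zero, if_pos rfl]
    · rw [lCoeff_eq_zero_of_shift hχ _ (g := 1) (by simp) (by simp)]
      · simp
      · simp [extendByOne, h]
    · rw [h2, if_neg (by omega)]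
  · ext n
    rw [PowerSeries.coeff_mk, map_add, PowerSeries.coeff_one]
    rcases n with _ | _ | n
    · rw [lCoeff_zero]; simp
    · rw [zero_add, PowerSeries.coeff_C_mul, PowerSeries.coeff_one_X, lCoeff, jacobiSum,
        Finset.mul_sum]
      simp only [one_ne_zero, if_false, zero_add, mul_one]
      symm
      refine Finset.sum_bij (fun x _ => X + C (1 - x)) ?_ ?_ ?_ ?_
      · intro x _
        exact mem_monicsOfDegree.2 ⟨monic_X_add_C _, natDegree_X_add_C _⟩
      · intro x _ y _ hxy
        simpa using hxy
      · intro f hf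
        obtain ⟨hm, hd⟩ := mem_monicsOfDegree.1 hf
        exact ⟨1 - f.coeff 0, Finset.mem_univ _, by
          rw [sub_sub_cancel]; exact (hm.eq_X_add_C hd).symm⟩
      · intro x _
        rw [MonoidHom.mul_apply, evalChar_apply, evalChar_apply, ← mul_assoc]
        simp only [extendByOne, h, if_false, eval_add, eval_X, eval_C, zero_add]
        rw [show (-1 : k) + (1 - x) = -1 * x by ring]
        change χ (-1) * χ x * ρ (1 - x) = χ (-1 * x) * ρ (1 - x)
        rw [map_mul]
    · rw [h2, PowerSeries.coeff_C_mul, PowerSeries.coeff_X]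
      simp

end HasseDavenport

section DistributionRelation

open Polynomial

variable {k : Type*} [Field k] [Fintype k]

/-- The sum of `∏ χ(w_i)` over the tuples `w` with sum `s`. -/
noncomputable def multiJacobiSum (ι : Type*) [Fintype ι] [DecidableEq ι] (χ : MulChar k ℂ)
    (s : k) : ℂ :=
  ∑ w : ι → k with ∑ i, w i = s, ∏ i, χ (w i)

variable {ι : Type*} [Fintype ι] [DecidableEq ι]

lemma multiJacobiSum_mul (χ : MulChar k ℂ) (c : kˣ) (s : k) :
    multiJacobiSum ι χ (c * s) = (χ ^ Fintype.card ι) (c : k) * multiJacobiSum ι χ s := by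
  rw [multiJacobiSum, multiJacobiSum, Finset.mul_sum]
  symm
  refine Finset.sum_bij (fun w _ i => c * w i) ?_ ?_ ?_ ?_
  · intro w hw
    rw [Finset.mem_filter] at hw ⊢
    exact ⟨Finset.mem_univ _, by rw [← Finset.mul_sum, hw.2]⟩
  · intro w _ w' _ h
    exact funext fun i => mul_left_cancel₀ c.ne_zero (congrFun h i)
  · intro w hw
    refine ⟨fun i => (c⁻¹ : kˣ) * w i, ?_, funext fun i => ?_⟩
    · rw [Finset.mem_filter] at hw ⊢
      exact ⟨Finset.mem_univ _, by rw [← Finset.mul_sum, hw.2, Units.inv_mul_cancel_left]⟩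
    · rw [Units.mul_inv_cancel_left]
  · intro w _
    simp_rw [map_mul]
    rw [Finset.prod_mul_distrib, Finset.prod_const, Finset.card_univ, MulChar.pow_apply_coe]

lemma multiJacobiSum_zero {χ : MulChar k ℂ} (hχ : χ ^ Fintype.card ι ≠ 1) :
    multiJacobiSum ι χ 0 = 0 := by
  obtain ⟨c, hc⟩ := MulChar.ne_one_iff.1 hχ
  have h := multiJacobiSum_mul (ι := ι) χ c 0
  rw [mul_zero] at h
  exact eq_zero_of_mul_eq_self_left hc h.symm

lemma AddChar.map_sum_eq_prod {A R ι : Type*} [AddCommMonoid A] [CommMonoid R] (ψ : AddChar A R)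
    (s : Finset ι) (f : ι → A) : ψ (∑ i ∈ s, f i) = ∏ i ∈ s, ψ (f i) :=
  map_prod ψ.toMonoidHom (fun i => Multiplicative.ofAdd (f i)) s

lemma gaussSum_pow_card_eq {χ : MulChar k ℂ} (hχ : χ ^ Fintype.card ι ≠ 1) (ψ : AddChar k ℂ) :
    gaussSum χ ψ ^ Fintype.card ι =
      gaussSum (χ ^ Fintype.card ι) ψ * multiJacobiSum ι χ 1 := by
  have h1 : ∀ s : k, multiJacobiSum ι χ s = (χ ^ Fintype.card ι) s * multiJacobiSum ι χ 1 := by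
    intro s
    by_cases hs : s = 0
    · rw [hs, multiJacobiSum_zero hχ, MulChar.map_zero, zero_mul]
    · simpa using multiJacobiSum_mul (ι := ι) χ (Units.mk0 s hs) 1
  calc gaussSum χ ψ ^ Fintype.card ι
      = ∏ _i : ι, ∑ x : k, χ x * ψ x := by
        rw [Finset.prod_const, Finset.card_univ, gaussSum]
    _ = ∑ w : ι → k, ∏ i, (χ (w i) * ψ (w i)) := by
        rw [Finset.prod_univ_sum, Fintype.piFinset_univ]
    _ = ∑ s : k, ∑ w : ι → k with ∑ i, w i = s, (∏ i, χ (w i)) * ψ s := by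
        rw [← Finset.sum_fiberwise (s := Finset.univ) (g := fun w : ι → k => ∑ i, w i)]
        refine Finset.sum_congr rfl fun s _ => Finset.sum_congr rfl fun w hw => ?_
        rw [← (Finset.mem_filter.1 hw).2, Finset.prod_mul_distrib, AddChar.map_sum_eq_prod]
    _ = _ := by
        rw [gaussSum, Finset.sum_mul]
        refine Finset.sum_congr rfl fun s _ => ?_
        rw [← Finset.sum_mul, ← multiJacobiSum, h1 s]
        ring

omit [Fintype k] in
lemma sum_nthRootsFinset_pow {a m : ℕ} {ζ : k} (hζ : IsPrimitiveRoot ζ a) (hm : 0 < m)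
    (hma : m < a) : ∑ z ∈ nthRootsFinset a (1 : k), z ^ m = 0 := by
  have ha : 0 < a := hm.trans hma
  refine eq_zero_of_mul_eq_self_left (hζ.pow_ne_one_of_pos_of_lt hm.ne' hma) ?_
  rw [Finset.mul_sum]
  refine Finset.sum_bij (fun z _ => ζ * z) ?_ ?_ ?_ ?_
  · intro z hz
    rw [mem_nthRootsFinset ha] at hz ⊢
    rw [mul_pow, hζ.pow_eq_one, hz, mul_one]
  · intro z _ z' _ h
    exact mul_left_cancel₀ (hζ.ne_zero ha.ne') h
  · intro z hz
    rw [mem_nthRootsFinset ha] at hz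
    refine ⟨ζ⁻¹ * z, ?_, mul_inv_cancel_left₀ (hζ.ne_zero ha.ne') z⟩
    rw [mem_nthRootsFinset ha, mul_pow, inv_pow, hζ.pow_eq_one, hz, inv_one, mul_one]
  · intro z _
    rw [mul_pow]

omit [Fintype k] in
lemma sum_nthRootsFinset_neg_mul_eval {a : ℕ} (ha : 1 ≤ a) {ζ : k} (hζ : IsPrimitiveRoot ζ a)
    {f : k[X]} (hf : f.natDegree < a) :
    ∑ z ∈ nthRootsFinset a (1 : k), -z * f.eval (-z) = (-1) ^ a * a * f.coeff (a - 1) := by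
  simp_rw [eval_eq_sum_range' hf, Finset.mul_sum]
  rw [Finset.sum_comm, Finset.sum_eq_single (a - 1)]
  · rw [Finset.sum_congr rfl (g := fun _ => (-1) ^ a * f.coeff (a - 1)), Finset.sum_const,
      hζ.card_nthRootsFinset, nsmul_eq_mul]
    · ring
    · intro z hz
      rw [mem_nthRootsFinset ha] at hz
      rw [mul_left_comm, ← pow_succ', Nat.sub_add_cancel ha, neg_pow, hz]
      ring
  · intro j hj hja
    rw [Finset.mem_range] at hj
    have h := sum_nthRootsFinset_pow hζ (Nat.succ_pos j) (by omega)
    rw [Finset.sum_congr rfl (g := fun z => (f.coeff j * (-1) ^ (j + 1)) * z ^ (j + 1)),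
      ← Finset.mul_sum, h, mul_zero]
    intro z _
    rw [mul_left_comm, ← pow_succ', neg_pow z, mul_assoc]
  · intro h
    exact absurd (Finset.mem_range.2 (by omega)) h

omit [Fintype k] in
lemma prod_nthRootsFinset_neg {a : ℕ} (ha : 1 ≤ a) {ζ : k} (hζ : IsPrimitiveRoot ζ a) :
    ∏ z ∈ nthRootsFinset a (1 : k), -z = -1 := by
  have h := congrArg (eval 0) (X_pow_sub_one_eq_prod ha hζ)
  simpa [eval_prod, show a ≠ 0 by omega] using h.symm

lemma multiJacobiSum_eq_lCoeff {a : ℕ} (ha : 1 ≤ a) {ζ : k} (hζ : IsPrimitiveRoot ζ a)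
    (χ : MulChar k ℂ) :
    multiJacobiSum (nthRootsFinset a (1 : k)) χ ((-1) ^ a * a) =
      χ (-1) * lCoeff (∏ z ∈ nthRootsFinset a (1 : k), evalChar χ.toMonoidHom (-z)) (a - 1) := by
  have hcard : Fintype.card (nthRootsFinset a (1 : k)) = a := by
    rw [Fintype.card_coe, hζ.card_nthRootsFinset]
  have hinj : Set.InjOn (fun z : nthRootsFinset a (1 : k) => -z.1)
      (Finset.univ : Finset (nthRootsFinset a (1 : k))) :=
    (neg_injective.comp Subtype.val_injective).injOn
  have hz0 : ∀ z : nthRootsFinset a (1 : k), -z.1 ≠ 0 := fun z hz => by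
    have := (mem_nthRootsFinset ha _).1 z.2
    rw [neg_eq_zero.1 hz, zero_pow (by omega)] at this
    exact zero_ne_one this
  have : NeZero a := ⟨by omega⟩
  have ha0 : (a : k) ≠ 0 := hζ.neZero'.ne
  have hdeg : ∀ f ∈ monicsOfDegree k (a - 1), f.degree <
      (Finset.univ : Finset (nthRootsFinset a (1 : k))).card := fun f hf => by
    obtain ⟨hm, hd⟩ := mem_monicsOfDegree.1 hf
    rw [degree_eq_natDegree hm.ne_zero, hd, Finset.card_univ, hcard]
    exact_mod_cast (by omega : a - 1 < a)
  rw [multiJacobiSum, lCoeff, Finset.mul_sum]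
  symm
  refine Finset.sum_bij (fun f _ z => -z.1 * f.eval (-z.1)) ?_ ?_ ?_ ?_
  · intro f hf
    obtain ⟨hm, hd⟩ := mem_monicsOfDegree.1 hf
    rw [Finset.mem_filter]
    refine ⟨Finset.mem_univ _, ?_⟩
    rw [Finset.sum_coe_sort (nthRootsFinset a (1 : k)) fun z => -z * f.eval (-z),
      sum_nthRootsFinset_neg_mul_eval ha hζ (by omega), ← hd, hm.coeff_natDegree, mul_one]
  · intro f hf g hg h
    exact Polynomial.eq_of_degrees_lt_of_eval_index_eq _ hinj (hdeg f hf) (hdeg g hg)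
      fun z _ => mul_left_cancel₀ (hz0 z) (congrFun h z)
  · intro w hw
    set f := Lagrange.interpolate Finset.univ (fun z : nthRootsFinset a (1 : k) => -z.1)
      (fun z => (-z.1)⁻¹ * w z) with hf
    have hfe : ∀ z : nthRootsFinset a (1 : k), -z.1 * f.eval (-z.1) = w z := fun z => by
      rw [hf, Lagrange.eval_interpolate_at_node _ hinj (Finset.mem_univ z),
        mul_inv_cancel_left₀ (hz0 z)]
    have hfd : f.degree < (a : ℕ) := by
      have := Lagrange.degree_interpolate_lt (fun z => (-z.1)⁻¹ * w z) hinj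
      rwa [Finset.card_univ, hcard] at this
    have hfn : f.natDegree < a := by
      by_cases h : f = 0
      · rw [h, natDegree_zero]; omega
      · exact (natDegree_lt_iff_degree_lt h).2 hfd
    have hfc : f.coeff (a - 1) = 1 := by
      have := sum_nthRootsFinset_neg_mul_eval ha hζ hfn
      rw [← Finset.sum_coe_sort, Finset.sum_congr rfl fun z _ => hfe z,
        (Finset.mem_filter.1 hw).2] at this
      exact mul_left_cancel₀ (mul_ne_zero (pow_ne_zero a (neg_ne_zero.2 one_ne_zero)) ha0)
        (this.symm.trans (mul_one _).symm)
    refine ⟨f, mem_monicsOfDegree.2 ?_, funext hfe⟩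
    have hd : f.natDegree = a - 1 :=
      le_antisymm (by omega) (le_natDegree_of_ne_zero (by rw [hfc]; exact one_ne_zero))
    exact ⟨by rw [Monic, leadingCoeff, hd, hfc], hd⟩
  · intro f _
    simp_rw [map_mul]
    rw [Finset.prod_mul_distrib, MonoidHom.finsetProd_apply,
      Finset.prod_coe_sort (nthRootsFinset a (1 : k)) fun z => χ (-z),
      Finset.prod_coe_sort (nthRootsFinset a (1 : k)) fun z => χ (f.eval (-z)),
      ← map_prod, prod_nthRootsFinset_neg ha hζ]
    rfl

lemma coeff_card_prod_one_add_C_mul_X {R ι : Type*} [CommRing R] (s : Finset ι)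
    (c : ι → R) :
    PowerSeries.coeff s.card (∏ i ∈ s, (1 + PowerSeries.C (c i) * PowerSeries.X)) =
      ∏ i ∈ s, c i := by
  have hpoly : ∏ i ∈ s, (1 + PowerSeries.C (c i) * PowerSeries.X) =
      ((∏ i ∈ s, (1 + C (c i) * X) : R[X]) : PowerSeries R) := by
    rw [← Polynomial.coeToPowerSeries.ringHom_apply, map_prod]
    refine Finset.prod_congr rfl fun i _ => ?_
    simp
  rw [hpoly, Polynomial.coeff_coe]
  have := coeff_prod_of_natDegree_le (s := s) (f := fun i => 1 + C (c i) * X) (n := 1)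
    fun i _ => by compute_degree
  rw [mul_one] at this
  rw [this]
  simp [coeff_one]

lemma multiJacobiSum_one_eq_prod_jacobiSum {a : ℕ} (ha : 1 ≤ a) (hak : a ∣ Fintype.card kˣ)
    {ζ : k} (hζ : IsPrimitiveRoot ζ a) {χ : MulChar k ℂ} (hχ : χ ≠ 1) :
    (χ ^ a) (a : k) * multiJacobiSum (nthRootsFinset a (1 : k)) χ 1 =
      ∏ ρ ∈ (Finset.univ : Finset {ρ : MulChar k ℂ // ρ ^ a = 1}).erase ⟨1, one_pow a⟩,
        jacobiSum χ ρ.1 := by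
  have hcard : Fintype.card (nthRootsFinset a (1 : k)) = a := by
    rw [Fintype.card_coe, hζ.card_nthRootsFinset]
  have : NeZero a := ⟨by omega⟩
  have ha0 : (a : k) ≠ 0 := hζ.neZero'.ne
  have hcard' : ((Finset.univ : Finset {ρ : MulChar k ℂ // ρ ^ a = 1}).erase
      ⟨1, one_pow a⟩).card = a - 1 := by
    rw [Finset.card_erase_of_mem (Finset.mem_univ _), Finset.card_univ,
      card_mulChar_pow_eq_one hak]
  have hcoeff := congrArg (PowerSeries.coeff (a - 1))
    (lSeries_prod_evalChar ha hak hζ χ.toMonoidHom)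
  simp_rw [lSeries_evalChar_mul hχ] at hcoeff
  rw [PowerSeries.coeff_mk, ← Finset.mul_prod_erase _ _
    (Finset.mem_univ (⟨1, one_pow a⟩ : {ρ : MulChar k ℂ // ρ ^ a = 1})), if_pos rfl, one_mul,
    Finset.prod_congr rfl fun ρ hρ => if_neg fun h => Finset.ne_of_mem_erase hρ (Subtype.ext h),
    ← hcard', coeff_card_prod_one_add_C_mul_X, Finset.prod_mul_distrib,
    Finset.prod_const, hcard'] at hcoeff
  have h1 := multiJacobiSum_eq_lCoeff ha hζ χ
  have h2 := multiJacobiSum_mul (ι := nthRootsFinset a (1 : k)) χ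
    ((-1) ^ a * Units.mk0 (a : k) ha0) 1
  rw [hcoeff] at h1
  have hsq : χ (-1) * χ (-1) = 1 := by rw [← map_mul, neg_mul_neg, one_mul, map_one]
  have hsign : (χ ^ a) ((-1 : k) ^ a) = χ (-1) ^ a := by
    rw [show ((-1 : k) ^ a) = (((-1) ^ a : kˣ) : k) by simp, MulChar.pow_apply_coe]
    simp only [Units.val_pow_eq_pow_val, Units.val_neg, Units.val_one, map_pow]
    rcases Nat.even_or_odd a with h | h
    · simp [← map_pow, h.neg_one_pow]
    · simp [← map_pow, h.neg_one_pow]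
  simp only [hcard, Units.val_mul, Units.val_pow_eq_pow_val, Units.val_neg, Units.val_one,
    Units.val_mk0, mul_one, map_mul, hsign, h1] at h2
  have hne : χ (-1) ^ a ≠ 0 := pow_ne_zero _ fun h => by simp [h] at hsq
  rw [← mul_assoc, ← pow_succ', Nat.sub_add_cancel ha, mul_assoc] at h2
  exact (mul_left_cancel₀ hne h2).symm

lemma gaussSum_ne_zero (χ : MulChar k ℂ) {ψ : AddChar k ℂ} (hψ : ψ ≠ 1) : gaussSum χ ψ ≠ 0 := by
  by_cases hχ : χ = 1
  · rw [hχ, gaussSum_one_left hψ]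
    exact neg_ne_zero.2 one_ne_zero
  · exact gaussSum_ne_zero_of_nontrivial (by exact_mod_cast Fintype.card_ne_zero) hχ
      (AddChar.IsPrimitive.of_ne_one hψ)

lemma prod_mulChar_pow_eq_one_mul_left {a : ℕ} {χ : MulChar k ℂ} (hχ : χ ^ a = 1)
    (f : MulChar k ℂ → ℂ) :
    ∏ ρ : {ρ : MulChar k ℂ // ρ ^ a = 1}, f (χ * ρ.1) =
      ∏ ρ : {ρ : MulChar k ℂ // ρ ^ a = 1}, f ρ.1 :=
  Fintype.prod_equiv ((Equiv.mulLeft χ).subtypeEquiv fun ρ => by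
    rw [Equiv.coe_mulLeft, mul_pow, hχ, one_mul]) _ _ fun _ => rfl

/-- The Hasse–Davenport product formula. -/
lemma prod_gaussSum_mul {a : ℕ} (ha : 1 ≤ a) (hak : a ∣ Fintype.card kˣ) (χ : MulChar k ℂ)
    {ψ : AddChar k ℂ} (hψ : ψ ≠ 1) :
    (χ ^ a) (a : k) * ∏ ρ : {ρ : MulChar k ℂ // ρ ^ a = 1}, gaussSum (χ * ρ.1) ψ =
      -(gaussSum (χ ^ a) ψ * ∏ ρ : {ρ : MulChar k ℂ // ρ ^ a = 1}, gaussSum ρ.1 ψ) := by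
  obtain ⟨ζ, hζ⟩ := exists_isPrimitiveRoot_of_dvd_card hak
  have : NeZero a := ⟨by omega⟩
  have ha0 : (a : k) ≠ 0 := hζ.neZero'.ne
  by_cases hχa : χ ^ a = 1
  · rw [hχa, gaussSum_one_left hψ, MulChar.one_apply ha0.isUnit, one_mul, neg_mul, neg_neg,
      one_mul]
    exact prod_mulChar_pow_eq_one_mul_left hχa fun χ => gaussSum χ ψ
  · have hχ : χ ≠ 1 := fun h => hχa (by rw [h, one_pow])
    have hcard : Fintype.card (nthRootsFinset a (1 : k)) = a := by
      rw [Fintype.card_coe, hζ.card_nthRootsFinset]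
    have hcard' : ((Finset.univ : Finset {ρ : MulChar k ℂ // ρ ^ a = 1}).erase
        ⟨1, one_pow a⟩).card = a - 1 := by
      rw [Finset.card_erase_of_mem (Finset.mem_univ _), Finset.card_univ,
        card_mulChar_pow_eq_one hak]
    have hg : gaussSum χ ψ ≠ 0 := gaussSum_ne_zero χ hψ
    have h1 := gaussSum_pow_card_eq (ι := nthRootsFinset a (1 : k)) (by rwa [hcard]) ψ
    rw [hcard] at h1
    have h2 := multiJacobiSum_one_eq_prod_jacobiSum ha hak hζ hχ
    have h3 : (∏ ρ ∈ (Finset.univ : Finset {ρ : MulChar k ℂ // ρ ^ a = 1}).erase ⟨1, one_pow a⟩,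
        gaussSum (χ * ρ.1) ψ) * ∏ ρ ∈ (Finset.univ : Finset {ρ : MulChar k ℂ //
          ρ ^ a = 1}).erase ⟨1, one_pow a⟩, jacobiSum χ ρ.1 = gaussSum χ ψ ^ (a - 1) *
        ∏ ρ ∈ (Finset.univ : Finset {ρ : MulChar k ℂ // ρ ^ a = 1}).erase ⟨1, one_pow a⟩,
          gaussSum ρ.1 ψ := by
      rw [← hcard', ← Finset.prod_const, ← Finset.prod_mul_distrib, ← Finset.prod_mul_distrib]
      refine Finset.prod_congr rfl fun ρ _ => jacobiSum_mul_nontrivial (fun h => hχa ?_) ψ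
      simpa [h, ρ.2] using (mul_pow χ ρ.1 a).symm
    rw [← Finset.mul_prod_erase _ _ (Finset.mem_univ ⟨1, one_pow a⟩),
      ← Finset.mul_prod_erase _ (fun ρ : {ρ : MulChar k ℂ // ρ ^ a = 1} => gaussSum ρ.1 ψ)
        (Finset.mem_univ ⟨1, one_pow a⟩), mul_one, gaussSum_one_left hψ]
    refine mul_left_cancel₀ (pow_ne_zero (a - 1) hg) ?_
    have h4 : gaussSum χ ψ ^ a = gaussSum χ ψ ^ (a - 1) * gaussSum χ ψ := by
      rw [← pow_succ, Nat.sub_add_cancel ha]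
    rw [h4] at h1
    rw [← h2] at h3
    linear_combination (χ ^ a) (a : k) * (∏ ρ ∈ (Finset.univ : Finset {ρ : MulChar k ℂ //
      ρ ^ a = 1}).erase ⟨1, one_pow a⟩, gaussSum (χ * ρ.1) ψ) * h1 + gaussSum (χ ^ a) ψ * h3

end DistributionRelation

section MellinTransform

variable {k : Type*} [Field k] [Fintype k]

lemma gaussSum_eq_sum_units (χ : MulChar k ℂ) (ψ : AddChar k ℂ) :
    gaussSum χ ψ = ∑ x : kˣ, χ (x : k) * ψ x := by
  rw [gaussSum, ← Fintype.sum_subtype_add_sum_subtype (fun x : k => x ≠ 0)]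
  have h0 : ∑ x : {x : k // ¬x ≠ 0}, χ x.1 * ψ x.1 = 0 :=
    Finset.sum_eq_zero fun x _ => by rw [not_ne_iff.1 x.2, MulChar.map_zero, zero_mul]
  rw [h0, add_zero]
  exact (Fintype.sum_equiv unitsEquivNeZero _ _ fun _ => rfl).symm

lemma eq_of_forall_sum_mulChar_mul_eq {f g : kˣ → ℂ}
    (h : ∀ χ : MulChar k ℂ, ∑ u : kˣ, χ (u : k) * f u = ∑ u : kˣ, χ (u : k) * g u) : f = g := by
  have hsum : ∀ (f : kˣ → ℂ) (v : kˣ), Fintype.card kˣ * f v =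
      ∑ ρ : {ρ : MulChar k ℂ // ρ ^ Fintype.card kˣ = 1},
        ρ.1 ((v⁻¹ : kˣ) : k) * ∑ u : kˣ, ρ.1 (u : k) * f u := by
    intro f v
    simp_rw [Finset.mul_sum, ← mul_assoc, ← map_mul, ← Units.val_mul]
    rw [Finset.sum_comm]
    simp_rw [← Finset.sum_mul, sum_mulChar_pow_eq_one dvd_rfl, pow_card_eq_one, exists_const]
    rw [Finset.sum_eq_single v]
    · rw [if_pos (inv_mul_cancel v).symm]
    · intro u _ hu
      rw [if_neg fun h => hu (inv_mul_eq_one.1 h.symm).symm, zero_mul]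
    · exact fun h => absurd (Finset.mem_univ v) h
  funext v
  have hcard : (Fintype.card kˣ : ℂ) ≠ 0 := by exact_mod_cast Fintype.card_ne_zero
  refine mul_left_cancel₀ hcard ?_
  rw [hsum, hsum]
  simp_rw [h]

lemma sum_mulChar_mul_sum_pow_eq (χ : MulChar k ℂ) (ψ : AddChar k ℂ) {a : ℕ} (ha : (a : k) ≠ 0) :
    (χ ^ a) (a : k) *
        ∑ u : kˣ, χ (u : k) * ∑ x : kˣ, (if x ^ a = u then ψ ((a : k) * x) else 0) =
      gaussSum (χ ^ a) ψ := by
  simp_rw [Finset.mul_sum, mul_ite, mul_zero]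
  rw [Finset.sum_comm, gaussSum_eq_sum_units,
    ← Equiv.sum_comp (Equiv.mulLeft (Units.mk0 (a : k) ha)) fun x : kˣ => (χ ^ a) (x : k) * ψ x]
  refine Finset.sum_congr rfl fun x _ => ?_
  rw [Finset.sum_ite_eq, if_pos (Finset.mem_univ _), Units.val_pow_eq_pow_val, map_pow,
    ← MulChar.pow_apply_coe, ← mul_assoc, ← map_mul]
  rfl

lemma sum_mulChar_mul_sum_prod_eq {ι : Type*} [Fintype ι] [DecidableEq ι]
    (χ : MulChar k ℂ) (ρ : ι → MulChar k ℂ)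
    (ψ : AddChar k ℂ) :
    ∑ u : kˣ, χ (u : k) * ∑ x : ι → kˣ,
        (if ∏ i, x i = u then ψ (∑ i, (x i : k)) * ∏ i, ρ i (x i : k) else 0) =
      ∏ i, gaussSum (χ * ρ i) ψ := by
  simp_rw [gaussSum_eq_sum_units, Finset.prod_univ_sum, Fintype.piFinset_univ, Finset.mul_sum,
    mul_ite, mul_zero]
  rw [Finset.sum_comm]
  refine Finset.sum_congr rfl fun x _ => ?_
  rw [Finset.sum_ite_eq, if_pos (Finset.mem_univ _), Units.coe_prod, map_prod,
    AddChar.map_sum_eq_prod, ← Finset.prod_mul_distrib, ← Finset.prod_mul_distrib]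
  refine Finset.prod_congr rfl fun i _ => ?_
  rw [MulChar.mul_apply]
  ring

lemma epsA_mul_cpow {a : ℕ} (ha : 1 ≤ a) (hak : a ∣ Fintype.card kˣ) (ψ : AddChar k ℂ) :
    epsA a ψ * (Fintype.card k : ℂ) ^ (-(((a : ℂ) - 1) / 2)) =
      (∏ ρ : {ρ : MulChar k ℂ // ρ ^ a = 1}, gaussSum ρ.1 ψ)⁻¹ := by
  have hq : (Fintype.card k : ℂ) ≠ 0 := by exact_mod_cast Fintype.card_ne_zero
  have hs : (Fintype.card k : ℂ) ^ (-(1 / 2 : ℂ)) ≠ 0 := by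
    rw [Complex.cpow_ne_zero_iff]
    exact Or.inl hq
  have hpow : (Fintype.card k : ℂ) ^ (-(((a : ℂ) - 1) / 2)) =
      ((Fintype.card k : ℂ) ^ (-(1 / 2 : ℂ))) ^ (a - 1) := by
    rw [← Complex.cpow_nat_mul, Nat.cast_sub ha, Nat.cast_one]
    congr 1
    ring
  have heps : ∀ χ : MulChar k ℂ, gaussEps ψ χ =
      (Fintype.card k : ℂ) ^ (-(1 / 2 : ℂ)) * gaussSum χ ψ := fun χ => by
    simp_rw [gaussEps, gaussSum_eq_sum_units, mul_comm]
  rw [epsA, finprod_eq_prod_of_fintype, hpow, Finset.prod_inv_distrib]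
  simp_rw [heps]
  rw [Finset.prod_mul_distrib, Finset.prod_const, Finset.card_univ,
    card_mulChar_pow_eq_one hak, mul_inv, mul_right_comm, mul_mul_mul_comm, mul_comm,
    ← Nat.sub_add_cancel ha, Nat.add_sub_cancel, pow_succ]
  field_simp

end MellinTransform

/-- the Hasse–Davenport identity expressing `-∑_{x^a = u} ψ(ax)` as a
normalized Kloosterman-type hypergeometric sum attached to the characters of order
dividing `a`. -/
theorem hasse_davenport_kloosterman {k : Type*} [Field k] [Fintype k]
    (a : ℕ) (ha : 1 ≤ a) (hak : a ∣ Fintype.card kˣ)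
    (ψ : AddChar k ℂ) (hψ : ψ ≠ 1) (u : kˣ) :
    -(∑ x : kˣ, if x ^ a = u then ψ ((a : k) * (x : k)) else 0) =
      epsA a ψ * (Fintype.card k : ℂ) ^ (-(((a : ℂ) - 1) / 2)) *
        ∑ᶠ x : ({ρ : MulChar k ℂ // ρ ^ a = 1} → kˣ),
          if (∏ᶠ ρ, x ρ) = u then
            ψ (∑ᶠ ρ, ((x ρ : k))) *
              ∏ᶠ ρ : {ρ : MulChar k ℂ // ρ ^ a = 1}, ρ.1 ((x ρ : k))
          else 0 := by
  have : NeZero a := ⟨by omega⟩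
  obtain ⟨ζ, hζ⟩ := exists_isPrimitiveRoot_of_dvd_card hak
  have ha0 : (a : k) ≠ 0 := hζ.neZero'.ne
  have hprod : ∏ ρ : {ρ : MulChar k ℂ // ρ ^ a = 1}, gaussSum ρ.1 ψ ≠ 0 :=
    Finset.prod_ne_zero_iff.2 fun ρ _ => gaussSum_ne_zero ρ.1 hψ
  rw [epsA_mul_cpow ha hak, finsum_eq_sum_of_fintype, eq_inv_mul_iff_mul_eq₀ hprod]
  simp_rw [finsum_eq_sum_of_fintype, finprod_eq_prod_of_fintype]
  revert u
  refine funext_iff.1 (eq_of_forall_sum_mulChar_mul_eq fun χ => ?_)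
  have hχ : (χ ^ a) (a : k) ≠ 0 := ((Units.mk0 _ ha0).isUnit.map (χ ^ a)).ne_zero
  refine mul_left_cancel₀ hχ ?_
  rw [sum_mulChar_mul_sum_prod_eq χ Subtype.val ψ, prod_gaussSum_mul ha hak χ hψ,
    ← sum_mulChar_mul_sum_pow_eq χ ψ ha0, Finset.mul_sum, Finset.mul_sum, Finset.sum_mul,
    ← Finset.sum_neg_distrib]
  exact Finset.sum_congr rfl fun u _ => by ring
end

section
/- Let q be a prime, k ≥ 2 an integer, ψ a nontrivial additive character of 𝔽_q and u ∈ 𝔽_q^×. Then (1/q) · Σ_{(x,y,z) ∈ (𝔽_q^×)^3, x·y^{k−1} = u·z^k} ψ(x+y+z) = ν − 1 + 1/q, where ν is the number of t ∈ 𝔽_q such that u·t^k + (−1)^k·(t+1)^{k−1} = 0. -/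
open scoped Classical

section FiniteField

variable {F : Type*} [Field F]

lemma sum_units_add_map_zero [Fintype F] [DecidableEq F] {M : Type*} [AddCommMonoid M] (f : F → M) :
    ∑ y : Fˣ, f y + f 0 = ∑ x : F, f x := by
  rw [← Fintype.sum_subtype_add_sum_subtype (· ≠ (0 : F)) f]
  congr 1
  · exact Fintype.sum_equiv unitsEquivNeZero _ _ fun _ => rfl
  · have : Unique {x : F // ¬ x ≠ 0} :=
      ⟨⟨0, by simp⟩, fun x => Subtype.ext (not_not.mp x.2)⟩
    rw [Fintype.sum_unique]
    exact congrArg f (not_not.mp (default : {x : F // ¬ x ≠ 0}).2).symm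

lemma AddChar.sum_units_mul [Fintype F] [DecidableEq F] {ψ : AddChar F ℂ} (hψ : ψ ≠ 1) (b : F) :
    ∑ y : Fˣ, ψ (y * b) = (if b = 0 then (Fintype.card F : ℂ) else 0) - 1 := by
  rw [eq_sub_iff_add_eq]
  have h := sum_units_add_map_zero fun y : F => ψ (y * b)
  rw [AddChar.sum_mulShift b (AddChar.IsPrimitive.of_ne_one hψ)] at h
  simpa using h

/-- The substitution `z = s y` turns the sum over the monomial surface into a sum over the
torus of pairs `(s, y)`. -/
lemma sum_monomial_surface_eq [Fintype F] [DecidableEq F] (ψ : AddChar F ℂ)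
    {k : ℕ} (hk : 1 ≤ k) (u : Fˣ) :
    (∑ x : Fˣ, ∑ y : Fˣ, ∑ z : Fˣ,
      if (x : F) * (y : F) ^ (k - 1) = (u : F) * (z : F) ^ k then ψ ((x : F) + y + z) else 0) =
      ∑ s : Fˣ, ∑ y : Fˣ, ψ (y * (u * s ^ k + (s + 1))) := by
  have key (x y s : Fˣ) :
      (x : F) * (y : F) ^ (k - 1) = (u : F) * ((s * y : Fˣ) : F) ^ k ↔ x = u * s ^ k * y := by
    obtain ⟨m, rfl⟩ := Nat.exists_eq_add_of_le' hk
    have h : (u : F) * ((s * y : Fˣ) : F) ^ (m + 1) = u * s ^ (m + 1) * y * y ^ m := by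
      push_cast
      ring
    rw [Nat.add_sub_cancel, h, mul_left_inj' (pow_ne_zero m y.ne_zero), Units.ext_iff]
    push_cast
    rfl
  calc
    _ = ∑ x : Fˣ, ∑ y : Fˣ, ∑ s : Fˣ,
        if x = u * s ^ k * y then ψ ((x : F) + y + (s * y : Fˣ)) else 0 := by
      refine Finset.sum_congr rfl fun x _ => Finset.sum_congr rfl fun y _ => ?_
      rw [← Equiv.sum_comp (Equiv.mulRight y)]
      simp only [Equiv.coe_mulRight, key]
    _ = ∑ y : Fˣ, ∑ s : Fˣ, ∑ x : Fˣ,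
        if x = u * s ^ k * y then ψ ((x : F) + y + (s * y : Fˣ)) else 0 := by
      rw [Finset.sum_comm]
      exact Finset.sum_congr rfl fun y _ => Finset.sum_comm
    _ = _ := by
      rw [Finset.sum_comm]
      refine Finset.sum_congr rfl fun s _ => Finset.sum_congr rfl fun y _ => ?_
      rw [Finset.sum_ite_eq' Finset.univ, if_pos (Finset.mem_univ _)]
      push_cast
      congr 1
      ring

lemma neg_div_add_one_add_one {t : F} (ht : t + 1 ≠ 0) : -t / (t + 1) + 1 = 1 / (t + 1) := by
  field_simp
  ring

/-- The involution `t ↦ -t / (t + 1)` exchanges the roots of `u X ^ k + X + 1` and those of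
`u X ^ k + (-1) ^ k (X + 1) ^ (k - 1)`. -/
lemma mobius_root_iff {k : ℕ} (hk : 1 ≤ k) (u : F) {t : F} (ht : t + 1 ≠ 0) :
    u * (-t / (t + 1)) ^ k + (-t / (t + 1) + 1) = 0 ↔
      u * t ^ k + (-1) ^ k * (t + 1) ^ (k - 1) = 0 := by
  obtain ⟨m, rfl⟩ := Nat.exists_eq_add_of_le' hk
  have h : u * t ^ (m + 1) + (-1) ^ (m + 1) * (t + 1) ^ m =
      (-1) ^ (m + 1) * (t + 1) ^ (m + 1) *
        (u * (-t / (t + 1)) ^ (m + 1) + (-t / (t + 1) + 1)) := by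
    have h1 : (-1 : F) ^ (m + 1) * (-1) ^ (m + 1) = 1 := by rw [← mul_pow]; simp
    have h2 : (t + 1) ^ (m + 1) * (-t / (t + 1)) ^ (m + 1) = (-1) ^ (m + 1) * t ^ (m + 1) := by
      rw [← mul_pow, mul_div_cancel₀ _ ht, neg_pow]
    have h3 : (t + 1) ^ (m + 1) * (1 / (t + 1)) = (t + 1) ^ m := by
      rw [pow_succ, mul_assoc, mul_one_div_cancel ht, mul_one]
    rw [neg_div_add_one_add_one ht]
    linear_combination (-u * t ^ (m + 1)) * h1 - (-1) ^ (m + 1) * u * h2 - (-1) ^ (m + 1) * h3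
  rw [Nat.add_sub_cancel, h]
  simp [ht]

lemma ncard_roots_eq {k : ℕ} (hk : 2 ≤ k) (u : Fˣ) :
    {t : F | (u : F) * t ^ k + (-1) ^ k * (t + 1) ^ (k - 1) = 0}.ncard =
      {s : Fˣ | (u : F) * s ^ k + (s + 1) = 0}.ncard := by
  have h0 : k ≠ 0 := by lia
  have h1 : k - 1 ≠ 0 := by lia
  have hs (s : Fˣ) (h : (u : F) * s ^ k + (s + 1) = 0) : (s : F) + 1 ≠ 0 := by
    intro h'
    simp [h'] at h
  have inv (t : F) (h : t + 1 ≠ 0) : -(-t / (t + 1)) / (-t / (t + 1) + 1) = t := by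
    rw [neg_div_add_one_add_one h]
    field_simp
  have ne (t : F) (h : t + 1 ≠ 0) : -t / (t + 1) + 1 ≠ 0 := by
    rw [neg_div_add_one_add_one h]
    exact one_div_ne_zero h
  symm
  refine Set.ncard_congr (fun s _ => -(s : F) / (s + 1)) ?_ ?_ ?_
  · intro s h
    have := hs s h
    rw [Set.mem_ofPred_eq, ← mobius_root_iff (by lia) _ (ne _ this), inv _ this]
    exact h
  · intro a b ha hb hab
    have hab : -(a : F) / (a + 1) = -(b : F) / (b + 1) := hab
    rw [Units.ext_iff, ← inv a (hs a ha), hab, inv b (hs b hb)]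
  · intro t h
    rw [Set.mem_ofPred_eq] at h
    have ht : t + 1 ≠ 0 := by
      intro h'
      obtain rfl : t = -1 := eq_neg_of_add_eq_zero_left h'
      simp [h1] at h
    have ht0 : t ≠ 0 := by
      rintro rfl
      simp [h0] at h
    refine ⟨Units.mk0 (-t / (t + 1)) (div_ne_zero (neg_ne_zero.mpr ht0) ht), ?_, inv t ht⟩
    exact (mobius_root_iff (by lia) _ ht).mpr h

end FiniteField

/-- explicit evaluation of the monomial sum `K_{1,k-1,-k}(u;ψ)`:
`(1/q) ∑_{x y^{k-1} = u z^k} ψ(x+y+z) = ν - 1 + 1/q` where `ν` is the number of roots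
in `𝔽_q` of the polynomial `u X^k + (-1)^k (X+1)^{k-1}`. -/
theorem K_one_kminusone_minusk_eval
    (q : ℕ) (hq : q.Prime) (k : ℕ) (hk : 2 ≤ k) :
    haveI : Fact q.Prime := ⟨hq⟩
    ∀ (ψ : AddChar (ZMod q) ℂ), ψ ≠ 1 → ∀ u : (ZMod q)ˣ,
    (1 / (q : ℂ)) * (∑ x : (ZMod q)ˣ, ∑ y : (ZMod q)ˣ, ∑ z : (ZMod q)ˣ,
        if (x : ZMod q) * (y : ZMod q) ^ (k - 1) = (u : ZMod q) * (z : ZMod q) ^ k then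
          ψ ((x : ZMod q) + (y : ZMod q) + (z : ZMod q))
        else 0) =
      (({t : ZMod q | (u : ZMod q) * t ^ k + (-1) ^ k * (t + 1) ^ (k - 1) = 0}.ncard : ℂ))
        - 1 + 1 / (q : ℂ) := by
  have : Fact q.Prime := ⟨hq⟩
  intro ψ hψ u
  have hq0 : (q : ℂ) ≠ 0 := Nat.cast_ne_zero.mpr hq.ne_zero
  have hcard : ((Fintype.card (ZMod q)ˣ : ℕ) : ℂ) = q - 1 := by
    rw [ZMod.card_units, Nat.cast_pred hq.pos]
  rw [sum_monomial_surface_eq ψ (by lia) u, ncard_roots_eq hk, Set.ncard_eq_toFinset_card']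
  simp only [AddChar.sum_units_mul hψ, Finset.sum_sub_distrib, ZMod.card, ← Finset.sum_filter,
    Finset.sum_const, nsmul_eq_mul, Finset.card_univ, hcard, Set.toFinset_ofPred]
  field_simp
  ring
end
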